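/- There exist a constant C > 0 and an integer N such that for every even integer n > N: |q^{-n(n-1+α)/2} γ_n − 2 (q²;q²)_∞²| ≤ C q^n and |q^{-(n-2)(n-1+α)/2} γ_{n-1} − 2 (q²;q²)_∞²| ≤ C q^n. -/

import Mathlib

open Polynomial

/-- The infinite q-Pochhammer symbol `(z; Q)_∞ = ∏_{j=0}^∞ (1 - z Q^j)`. -/
noncomputable def qpochInf (z : ℂ) (Q : ℝ) : ℂ := ∏' j : ℕ, (1 - z * (Q : ℂ) ^ j)


/-- coefficient A -/
noncomputable def lqA (Q s : ℝ) (m : ℕ) : ℝ :=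
  Q ^ m * (1 - s * Q ^ m) ^ 2 / ((1 - s * Q ^ (2 * m)) * (1 - s * Q ^ (2 * m + 1)))
/-- coefficient C (shifted) -/
noncomputable def lqC (Q s : ℝ) (m : ℕ) : ℝ :=
  s * Q ^ m * (1 - Q ^ (m + 1)) ^ 2 / ((1 - s * Q ^ (2 * m + 1)) * (1 - s * Q ^ (2 * m + 2)))

/-- monic little q-Jacobi polynomials with b = 1 -/
noncomputable def lq (Q s : ℝ) : ℕ → ℝ[X]
  | 0 => 1
  | 1 => X - C (lqA Q s 0)
  | m + 2 => (X - C (lqA Q s (m + 1) + lqC Q s m)) * lq Q s (m + 1)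
      - C (lqA Q s m * lqC Q s m) * lq Q s m

noncomputable def lqκ (Q s : ℝ) : ℕ → ℝ
  | 0 => 1
  | m + 1 => lqκ Q s m * (-(Q ^ m * s * (1 - Q ^ (m + 1)) * (1 - s * Q ^ m)) /
      ((1 - s * Q ^ (2 * m)) * (1 - s * Q ^ (2 * m + 1))))

noncomputable def lqT (Q : ℝ) (m : ℕ) (z : ℝ) : ℝ := ∏ i ∈ Finset.range m, (z - Q ^ i)
noncomputable def lqD (Q s : ℝ) (m : ℕ) (z : ℝ) : ℝ := ∏ i ∈ Finset.range (m + 1), (1 - s * Q ^ i * z)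

lemma lqT_mul (Q : ℝ) (m : ℕ) (z : ℝ) :
    lqT Q (m + 1) (Q * z) = (Q * z - 1) * Q ^ m * lqT Q m z := by
  unfold lqT
  rw [Finset.prod_range_succ']
  have : ∀ i ∈ Finset.range m, (Q * z - Q ^ (i + 1)) = Q * (z - Q ^ i) := by intro i _; ring
  rw [Finset.prod_congr rfl this, Finset.prod_mul_distrib]
  simp; ring

lemma lqD_mul (Q s : ℝ) (m : ℕ) (z : ℝ) :
    lqD Q s m (Q * z) * (1 - s * z) = lqD Q s (m + 1) z := by
  unfold lqD
  rw [Finset.prod_range_succ' _ (m + 1)]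
  have : ∀ i ∈ Finset.range (m + 1), (1 - s * Q ^ i * (Q * z)) = (1 - s * Q ^ (i + 1) * z) := by
    intro i _; ring
  rw [Finset.prod_congr rfl this]
  simp

lemma lqT_succ (Q : ℝ) (m : ℕ) (z : ℝ) : lqT Q (m + 1) z = lqT Q m z * (z - Q ^ m) := by
  unfold lqT; rw [Finset.prod_range_succ]
lemma lqD_succ (Q s : ℝ) (m : ℕ) (z : ℝ) :
    lqD Q s (m + 1) z = lqD Q s m z * (1 - s * Q ^ (m + 1) * z) := by
  unfold lqD; rw [Finset.prod_range_succ]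

lemma one_sub_pos_aux {Q s : ℝ} (hQ0 : 0 < Q) (hQ1 : Q < 1) (hs0 : 0 < s) (hs1 : s < 1) (j : ℕ) :
    0 < 1 - s * Q ^ j := by
  have : Q ^ j ≤ 1 := pow_le_one₀ hQ0.le hQ1.le
  have h2 : 0 < Q ^ j := pow_pos hQ0 j
  nlinarith

noncomputable def lqR (Q s : ℝ) (m : ℕ) (z : ℝ) : ℝ := lqκ Q s m * lqT Q m z / lqD Q s m z

lemma lqR_rec_alg (Q s x z t d κ e0 e1 e2 e3 f0 f1 f2 : ℝ)
    (he0 : e0 = 1 - s * x ^ 2) (he1 : e1 = 1 - s * (x ^ 2 * Q)) (he2 : e2 = 1 - s * (x ^ 2 * Q ^ 2))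
    (he3 : e3 = 1 - s * (x ^ 2 * Q ^ 3)) (hf0 : f0 = 1 - s * z) (hf1 : f1 = 1 - s * (x * Q) * z)
    (hf2 : f2 = 1 - s * (x * Q ^ 2) * z)
    (h1 : f0 ≠ 0) (h0 : e0 ≠ 0) (h2 : e1 ≠ 0) (h3 : e2 ≠ 0)
    (h4 : e3 ≠ 0) (hd : d ≠ 0) (h5 : f1 ≠ 0) (h6 : f2 ≠ 0) :
    κ * (-(x * s * (1 - x * Q) * (1 - s * x)) / (e0 * e1)) *
      (-(x * Q * s * (1 - x * Q ^ 2) * (1 - s * (x * Q))) / (e2 * e3)) *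
      (t * (z - x) * (z - x * Q)) / (d * f1 * f2) =
    κ * (-(x * s * (1 - x * Q) * (1 - s * x)) / (e0 * e1)) *
      ((Q * z - 1) * x * t) / (d * f1 * f2 / f0) -
    (x * Q * (1 - s * (x * Q)) ^ 2 / (e2 * e3) + s * x * (1 - x * Q) ^ 2 / (e1 * e2)) *
     (κ * (-(x * s * (1 - x * Q) * (1 - s * x)) / (e0 * e1)) * (t * (z - x)) / (d * f1)) -
    (x * (1 - s * x) ^ 2 / (e0 * e1) * (s * x * (1 - x * Q) ^ 2 / (e1 * e2))) * (κ * t / d) := by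
  field_simp
  subst he0 he1 he2 he3 hf0 hf1 hf2
  ring

lemma lqD_ne {Q s : ℝ} (hQ0 : 0 < Q) (hQ1 : Q < 1) (hs0 : 0 < s) (hs1 : s < 1) (m j : ℕ) :
    lqD Q s m (Q ^ j) ≠ 0 := by
  unfold lqD
  rw [Finset.prod_ne_zero_iff]
  intro i _
  rw [mul_assoc, ← pow_add]
  exact (one_sub_pos_aux hQ0 hQ1 hs0 hs1 _).ne'

lemma lqR_rec {Q s : ℝ} (hQ0 : 0 < Q) (hQ1 : Q < 1) (hs0 : 0 < s) (hs1 : s < 1) (m j : ℕ) :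
    lqR Q s (m + 2) (Q ^ j) = lqR Q s (m + 1) (Q ^ (j + 1)) -
      (lqA Q s (m + 1) + lqC Q s m) * lqR Q s (m + 1) (Q ^ j) -
      (lqA Q s m * lqC Q s m) * lqR Q s m (Q ^ j) := by
  have hp := fun j => (one_sub_pos_aux hQ0 hQ1 hs0 hs1 j).ne'
  have hf : 1 - s * Q ^ j ≠ 0 := hp j
  have hD := lqD_mul Q s (m + 1) (Q ^ j)
  have hD' : lqD Q s (m + 1) (Q * Q ^ j) = lqD Q s (m + 2) (Q ^ j) / (1 - s * Q ^ j) := by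
    rw [← hD, mul_div_assoc, div_self hf, mul_one]
  have key := lqR_rec_alg Q s (Q ^ m) (Q ^ j) (lqT Q m (Q ^ j)) (lqD Q s m (Q ^ j)) (lqκ Q s m)
    _ _ _ _ _ _ _ rfl rfl rfl rfl rfl rfl rfl hf
    (by convert hp (2 * m) using 3; ring) (by convert hp (2 * m + 1) using 3; ring)
    (by convert hp (2 * m + 2) using 3; ring) (by convert hp (2 * m + 3) using 3; ring)
    (lqD_ne hQ0 hQ1 hs0 hs1 m j)
    (by convert hp (m + 1 + j) using 2; ring) (by convert hp (m + 2 + j) using 2; ring)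
  unfold lqR
  rw [pow_succ' Q j, hD', lqT_mul, lqD_succ Q s (m + 1), lqD_succ Q s m, lqT_succ Q (m + 1), lqT_succ Q m]
  simp only [lqκ, lqA, lqC]
  convert key using 1 <;> ring_nf

lemma lqR_one {Q s : ℝ} (hQ0 : 0 < Q) (hQ1 : Q < 1) (hs0 : 0 < s) (hs1 : s < 1) (j : ℕ) :
    lqR Q s 1 (Q ^ j) = 1 / (1 - s * Q ^ (j + 1)) - lqA Q s 0 * (1 / (1 - s * Q ^ j)) := by
  have h1 := (one_sub_pos_aux hQ0 hQ1 hs0 hs1 j).ne'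
  have h2 := (one_sub_pos_aux hQ0 hQ1 hs0 hs1 (j + 1)).ne'
  have h3 := (one_sub_pos_aux hQ0 hQ1 hs0 hs1 0).ne'
  have h4 := (one_sub_pos_aux hQ0 hQ1 hs0 hs1 1).ne'
  simp only [lqR, lqκ, lqT, lqD, lqA, Finset.prod_range_succ, Finset.prod_range_zero]
  simp only [pow_succ, pow_zero, one_mul, mul_one, mul_zero, zero_add] at *
  rw [show s * Q * Q ^ j = s * (Q ^ j * Q) by ring]
  generalize Q ^ j = z at *
  have e1 : ∃ a, a = 1 - s * z := ⟨_, rfl⟩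
  have e2 : ∃ a, a = 1 - s * (z * Q) := ⟨_, rfl⟩
  have e3 : ∃ a, a = 1 - s := ⟨_, rfl⟩
  have e4 : ∃ a, a = 1 - s * Q := ⟨_, rfl⟩
  obtain ⟨a, ha⟩ := e1
  obtain ⟨b, hb⟩ := e2
  obtain ⟨c, hc⟩ := e3
  obtain ⟨d, hd⟩ := e4
  rw [← ha] at h1 ⊢
  rw [← hb] at h2 ⊢
  rw [← hc] at h3 ⊢
  rw [← hd] at h4 ⊢
  field_simp
  subst ha hb hc hd
  ring

lemma poly_bdd (p : ℝ[X]) : ∃ K, ∀ x ∈ Set.Icc (0 : ℝ) 1, ‖p.eval x‖ ≤ K :=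
  (isCompact_Icc).exists_bound_of_continuousOn p.continuous.continuousOn

lemma lq_summable {Q s : ℝ} (hQ0 : 0 < Q) (hQ1 : Q < 1) (hs0 : 0 < s) (hs1 : s < 1) (p : ℝ[X]) :
    Summable (fun k : ℕ => s ^ k * p.eval (Q ^ k)) := by
  obtain ⟨K, hK⟩ := poly_bdd p
  refine Summable.of_norm_bounded ((summable_geometric_of_lt_one hs0.le hs1).mul_right K) ?_
  intro k
  rw [norm_mul, Real.norm_of_nonneg (pow_nonneg hs0.le k)]
  exact mul_le_mul_of_nonneg_left (hK _ ⟨by positivity, pow_le_one₀ hQ0.le hQ1.le⟩) (by positivity)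

noncomputable def lqJ (Q s : ℝ) (p : ℝ[X]) : ℝ := ∑' k : ℕ, s ^ k * p.eval (Q ^ k)

section
variable {Q s : ℝ} (hQ0 : 0 < Q) (hQ1 : Q < 1) (hs0 : 0 < s) (hs1 : s < 1)

lemma lqJ_add (hQ0 : 0 < Q) (hQ1 : Q < 1) (hs0 : 0 < s) (hs1 : s < 1) (p g : ℝ[X]) :
    lqJ Q s (p + g) = lqJ Q s p + lqJ Q s g := by
  unfold lqJ
  rw [← (lq_summable hQ0 hQ1 hs0 hs1 p).tsum_add (lq_summable hQ0 hQ1 hs0 hs1 g)]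
  simp [mul_add]

lemma lqJ_C_mul (a : ℝ) (p : ℝ[X]) : lqJ Q s (C a * p) = a * lqJ Q s p := by
  unfold lqJ
  rw [← tsum_mul_left]
  congr 1; ext k; simp; ring

lemma lqJ_sub (hQ0 : 0 < Q) (hQ1 : Q < 1) (hs0 : 0 < s) (hs1 : s < 1) (p g : ℝ[X]) :
    lqJ Q s (p - g) = lqJ Q s p - lqJ Q s g := by
  unfold lqJ
  rw [← (lq_summable hQ0 hQ1 hs0 hs1 p).tsum_sub (lq_summable hQ0 hQ1 hs0 hs1 g)]
  simp [mul_sub]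

lemma lqJ_X_pow (hQ0 : 0 < Q) (hQ1 : Q < 1) (hs0 : 0 < s) (hs1 : s < 1) (j : ℕ) :
    lqJ Q s (X ^ j) = 1 / (1 - s * Q ^ j) := by
  unfold lqJ
  have : ∀ k : ℕ, s ^ k * (X ^ j : ℝ[X]).eval (Q ^ k) = (s * Q ^ j) ^ k := by
    intro k; simp [mul_pow]; left; rw [← pow_mul, ← pow_mul, mul_comm]
  simp_rw [this]
  have h := one_sub_pos_aux hQ0 hQ1 hs0 hs1 j
  rw [tsum_geometric_of_lt_one (by positivity) (by linarith), one_div]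

lemma lqJ_lq (hQ0 : 0 < Q) (hQ1 : Q < 1) (hs0 : 0 < s) (hs1 : s < 1) (m : ℕ) :
    ∀ j, lqJ Q s (lq Q s m * X ^ j) = lqR Q s m (Q ^ j) := by
  induction m using Nat.twoStepInduction with
  | zero => intro j; simp [lq, lqJ_X_pow hQ0 hQ1 hs0 hs1, lqR, lqκ, lqT, lqD]
  | one =>
    intro j
    rw [lqR_one hQ0 hQ1 hs0 hs1]
    rw [lq, sub_mul, ← pow_succ', lqJ_sub hQ0 hQ1 hs0 hs1, lqJ_C_mul,
      lqJ_X_pow hQ0 hQ1 hs0 hs1, lqJ_X_pow hQ0 hQ1 hs0 hs1]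
  | more m ih1 ih2 =>
    intro j
    rw [lqR_rec hQ0 hQ1 hs0 hs1, ← ih2, ← ih2, ← ih1, ← lqJ_C_mul, ← lqJ_C_mul,
      ← lqJ_sub hQ0 hQ1 hs0 hs1, ← lqJ_sub hQ0 hQ1 hs0 hs1]
    congr 1
    rw [lq]
    ring

lemma lqJ_orth (hQ0 : 0 < Q) (hQ1 : Q < 1) (hs0 : 0 < s) (hs1 : s < 1) {m j : ℕ} (h : j < m) :
    lqJ Q s (lq Q s m * X ^ j) = 0 := by
  rw [lqJ_lq hQ0 hQ1 hs0 hs1, lqR, lqT, Finset.prod_eq_zero (Finset.mem_range.2 h) (sub_self _)]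
  simp

lemma lq_monic (m : ℕ) : (lq Q s m).Monic ∧ (lq Q s m).natDegree = m := by
  induction m using Nat.twoStepInduction with
  | zero => simp [lq]
  | one => exact ⟨monic_X_sub_C _, natDegree_X_sub_C _⟩
  | more m ih1 ih2 =>
    rw [lq]
    have hm := (monic_X_sub_C (lqA Q s (m + 1) + lqC Q s m)).mul ih2.1
    have hd : ((X - C (lqA Q s (m + 1) + lqC Q s m)) * lq Q s (m + 1)).natDegree = m + 2 := by
      rw [(monic_X_sub_C _).natDegree_mul ih2.1, natDegree_X_sub_C, ih2.2]; omega
    have hlt : (C (lqA Q s m * lqC Q s m) * lq Q s m).natDegree <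
        ((X - C (lqA Q s (m + 1) + lqC Q s m)) * lq Q s (m + 1)).natDegree := by
      rw [hd]
      refine (natDegree_C_mul_le _ _).trans_lt ?_
      rw [ih1.2]; omega
    refine ⟨hm.sub_of_left (degree_lt_degree hlt), ?_⟩
    rw [natDegree_sub_eq_left_of_natDegree_lt hlt, hd]
end


section
variable {Q s : ℝ}

lemma lqJ_orth_poly (hQ0 : 0 < Q) (hQ1 : Q < 1) (hs0 : 0 < s) (hs1 : s < 1) {m : ℕ} (g : ℝ[X])
    (hg : g.degree < m) : lqJ Q s (lq Q s m * g) = 0 := by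
  by_cases h0 : g = 0
  · subst h0; simp [lqJ]
  have hn : g.natDegree < m := by rwa [natDegree_lt_iff_degree_lt h0]
  rw [g.as_sum_range_C_mul_X_pow' hn]
  have : ∀ n ≤ m, lqJ Q s (lq Q s m * ∑ i ∈ Finset.range n, C (g.coeff i) * X ^ i) = 0 := by
    intro n
    induction n with
    | zero => intro _; simp [lqJ]
    | succ n ih =>
      intro hnm
      rw [Finset.sum_range_succ, mul_add, lqJ_add hQ0 hQ1 hs0 hs1, ih (by omega), mul_left_comm,
        lqJ_C_mul, lqJ_orth hQ0 hQ1 hs0 hs1 (by omega)]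
      simp
  exact this m le_rfl

noncomputable def lqH (Q s : ℝ) (m : ℕ) : ℝ := lqJ Q s (lq Q s m * lq Q s m)

lemma lqH_eq_R (hQ0 : 0 < Q) (hQ1 : Q < 1) (hs0 : 0 < s) (hs1 : s < 1) (m : ℕ) :
    lqH Q s m = lqR Q s m (Q ^ m) := by
  rw [← lqJ_lq hQ0 hQ1 hs0 hs1, lqH]
  have h : (lq Q s m - X ^ m).degree < (m : WithBot ℕ) := by
    have h1 := lq_monic (Q := Q) (s := s) m
    have h2 : (lq Q s m).degree = m := by rw [degree_eq_natDegree h1.1.ne_zero, h1.2]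
    rw [← h2]
    apply degree_sub_lt
    · rw [h2, degree_X_pow]
    · exact h1.1.ne_zero
    · rw [h1.1.leadingCoeff, (monic_X_pow m).leadingCoeff]
  have := lqJ_orth_poly hQ0 hQ1 hs0 hs1 _ h
  rw [mul_sub, lqJ_sub hQ0 hQ1 hs0 hs1] at this
  linarith

/-- finite q-Pochhammer -/
noncomputable def lqP (Q s : ℝ) (m : ℕ) : ℝ := ∏ i ∈ Finset.range m, (1 - s * Q ^ i)

lemma lqP_pos (hQ0 : 0 < Q) (hQ1 : Q < 1) (hs0 : 0 < s) (hs1 : s < 1) (m : ℕ) :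
    0 < lqP Q s m := Finset.prod_pos fun i _ => one_sub_pos_aux hQ0 hQ1 hs0 hs1 i

lemma lqP_succ (m : ℕ) : lqP Q s (m + 1) = lqP Q s m * (1 - s * Q ^ m) := by
  rw [lqP, Finset.prod_range_succ, lqP]

lemma lqD_eq (m : ℕ) : lqP Q s (2 * m + 1) = lqP Q s m * lqD Q s m (Q ^ m) := by
  rw [lqP, show 2 * m + 1 = m + (m + 1) by ring, Finset.prod_range_add, lqP, lqD]
  congr 1
  apply Finset.prod_congr rfl
  intro i _
  rw [pow_add]; ring

lemma lqκT (hQ0 : 0 < Q) (hQ1 : Q < 1) (hs0 : 0 < s) (hs1 : s < 1) (m : ℕ) :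
    lqκ Q s m * lqT Q m (Q ^ m) =
      (s ^ m * Q ^ (m * m) / Q ^ m) * (lqP Q Q m ^ 2 * lqP Q s m / lqP Q s (2 * m)) := by
  induction m with
  | zero => simp [lqκ, lqT, lqP]
  | succ m ih =>
    have hp := fun j => (one_sub_pos_aux hQ0 hQ1 hs0 hs1 j).ne'
    have hP := (lqP_pos hQ0 hQ1 hs0 hs1 (2 * m)).ne'
    have hQm : Q ^ m ≠ 0 := by positivity
    rw [pow_succ' Q m, lqT_mul, lqκ]
    rw [show lqκ Q s m * (-(Q ^ m * s * (1 - Q ^ (m + 1)) * (1 - s * Q ^ m)) /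
      ((1 - s * Q ^ (2 * m)) * (1 - s * Q ^ (2 * m + 1)))) * ((Q * Q ^ m - 1) * Q ^ m * lqT Q m (Q ^ m))
      = (lqκ Q s m * lqT Q m (Q ^ m)) * ((-(Q ^ m * s * (1 - Q ^ (m + 1)) * (1 - s * Q ^ m)) /
      ((1 - s * Q ^ (2 * m)) * (1 - s * Q ^ (2 * m + 1)))) * ((Q * Q ^ m - 1) * Q ^ m)) by ring, ih]
    rw [show 2 * (m + 1) = 2 * m + 1 + 1 by ring, lqP_succ, lqP_succ, lqP_succ, lqP_succ]
    have h1 := hp (2 * m)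
    have h2 := hp (2 * m + 1)
    generalize 1 - s * Q ^ (2 * m) = a at *
    generalize 1 - s * Q ^ (2 * m + 1) = b at *
    rw [show (m + 1) * (m + 1) = m * m + m + m + 1 by ring]
    simp only [pow_succ, pow_add]
    field_simp
    ring

noncomputable def lqt (Q s : ℝ) (m : ℕ) : ℝ :=
  lqP Q Q m ^ 2 * lqP Q s m ^ 2 / (lqP Q s (2 * m) * lqP Q s (2 * m + 1))

lemma lqH_eq (hQ0 : 0 < Q) (hQ1 : Q < 1) (hs0 : 0 < s) (hs1 : s < 1) (m : ℕ) :
    lqH Q s m = (s ^ m * Q ^ (m * m) / Q ^ m) * lqt Q s m := by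
  rw [lqH_eq_R hQ0 hQ1 hs0 hs1, lqR, lqκT hQ0 hQ1 hs0 hs1, lqt, lqD_eq]
  have h1 := lqD_ne hQ0 hQ1 hs0 hs1 m m
  have h2 := (lqP_pos hQ0 hQ1 hs0 hs1 m).ne'
  have h3 := (lqP_pos hQ0 hQ1 hs0 hs1 (2 * m)).ne'
  have hQm : Q ^ m ≠ 0 := by positivity
  field_simp

lemma lqt_pos (hQ0 : 0 < Q) (hQ1 : Q < 1) (hs0 : 0 < s) (hs1 : s < 1) (m : ℕ) :
    0 < lqt Q s m := by
  have h1 := lqP_pos hQ0 hQ1 hs0 hs1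
  have h2 := lqP_pos hQ0 hQ1 hQ0 hQ1
  have := h1 m
  have := h1 (2 * m)
  have := h1 (2 * m + 1)
  have := h2 m
  unfold lqt
  positivity

open Filter Topology Asymptotics

noncomputable def lqPinf (Q s : ℝ) : ℝ := ∏' j : ℕ, (1 - s * Q ^ j)

lemma lqPinf_mult (hQ0 : 0 < Q) (hQ1 : Q < 1) : Multipliable (fun j : ℕ => 1 - s * Q ^ j) := by
  have := multipliable_one_add_of_summable (f := fun j : ℕ => -(s * Q ^ j))
    (((summable_geometric_of_lt_one hQ0.le hQ1).mul_left s).neg.norm)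
  simpa [sub_eq_add_neg] using this

lemma lqP_tendsto (hQ0 : 0 < Q) (hQ1 : Q < 1) :
    Tendsto (lqP Q s) atTop (𝓝 (lqPinf Q s)) :=
  (lqPinf_mult (s := s) hQ0 hQ1).hasProd.tendsto_prod_nat

lemma lqPinf_ne (hQ0 : 0 < Q) (hQ1 : Q < 1) (hs0 : 0 < s) (hs1 : s < 1) : lqPinf Q s ≠ 0 := by
  have := tprod_one_add_ne_zero_of_summable (f := fun j : ℕ => -(s * Q ^ j))
    (fun j => by
      have := one_sub_pos_aux hQ0 hQ1 hs0 hs1 j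
      rw [← sub_eq_add_neg]; exact this.ne')
    (((summable_geometric_of_lt_one hQ0.le hQ1).mul_left s).neg.norm)
  simpa [sub_eq_add_neg, lqPinf] using this

lemma lqP_dist (hQ0 : 0 < Q) (hQ1 : Q < 1) (hs0 : 0 < s) (hs1 : s < 1) (m : ℕ) :
    |lqP Q s m - lqPinf Q s| ≤ 1 / (1 - Q) * Q ^ m := by
  have := dist_le_of_le_geometric_of_tendsto (r := Q) (C := 1) (f := lqP Q s) hQ1 (fun n => by
    rw [Real.dist_eq, lqP_succ]
    have h1 := lqP_pos hQ0 hQ1 hs0 hs1 n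
    have h2 : lqP Q s n ≤ 1 := Finset.prod_le_one
      (fun i _ => (one_sub_pos_aux hQ0 hQ1 hs0 hs1 i).le) (fun i _ => by
        have : 0 < s * Q ^ i := by positivity
        linarith)
    have h3 : 0 < Q ^ n := by positivity
    rw [show lqP Q s n - lqP Q s n * (1 - s * Q ^ n) = lqP Q s n * s * Q ^ n by ring,
      abs_of_pos (by positivity)]
    gcongr
    nlinarith) (lqP_tendsto hQ0 hQ1) m
  rw [Real.dist_eq] at this
  rwa [div_mul_eq_mul_div]

lemma lqt_O (hQ0 : 0 < Q) (hQ1 : Q < 1) (hs0 : 0 < s) (hs1 : s < 1) :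
    (fun m => lqt Q s m - lqPinf Q Q ^ 2) =O[atTop] (fun m => Q ^ m) := by
  have hO : ∀ s', 0 < s' → s' < 1 → ∀ f : ℕ → ℕ, (∀ m, m ≤ f m) →
      (fun m => lqP Q s' (f m) - lqPinf Q s') =O[atTop] (fun m => Q ^ m) := by
    intro s' h0 h1 f hf
    refine IsBigO.of_bound (1 / (1 - Q)) (Eventually.of_forall fun m => ?_)
    rw [Real.norm_eq_abs, Real.norm_of_nonneg (by positivity)]
    refine (lqP_dist hQ0 hQ1 h0 h1 (f m)).trans ?_
    have : Q ^ f m ≤ Q ^ m := pow_le_pow_of_le_one hQ0.le hQ1.le (hf m)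
    have : 0 < 1 - Q := by linarith
    gcongr
  have hQt : Tendsto (fun m : ℕ => Q ^ m) atTop (𝓝 0) := tendsto_pow_atTop_nhds_zero_of_lt_one hQ0.le hQ1
  -- product rule
  have hmul : ∀ (u v : ℕ → ℝ) (a b : ℝ), (fun m => u m - a) =O[atTop] (fun m => Q ^ m) →
      (fun m => v m - b) =O[atTop] (fun m => Q ^ m) →
      (fun m => u m * v m - a * b) =O[atTop] (fun m => Q ^ m) := by
    intro u v a b hu hv
    have hub : v =O[atTop] (fun _ => (1 : ℝ)) := by
      have : Tendsto v atTop (𝓝 b) := by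
        have := (hv.trans_tendsto hQt).add_const b
        simpa using this
      exact this.isBigO_one ℝ
    have h1 := hu.mul hub
    have h2 := hv.const_mul_left a
    simp only [mul_one] at h1
    refine (h1.add h2).congr_left fun m => by ring
  have hinv : ∀ (u : ℕ → ℝ) (a : ℝ), a ≠ 0 → (fun m => u m - a) =O[atTop] (fun m => Q ^ m) →
      (fun m => (u m)⁻¹ - a⁻¹) =O[atTop] (fun m => Q ^ m) := by
    intro u a ha hu
    have ht : Tendsto u atTop (𝓝 a) := by
        have := (hu.trans_tendsto hQt).add_const a
        simpa using this
    have hb : (fun m => (u m)⁻¹) =O[atTop] (fun _ => (1 : ℝ)) := (ht.inv₀ ha).isBigO_one ℝ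
    have h1 := (hu.mul hb).const_mul_left (-a⁻¹)
    simp only [mul_one] at h1
    refine h1.congr' ?_ EventuallyEq.rfl
    filter_upwards [ht.eventually_ne ha] with m hm
    field_simp
    ring
  have hne := lqPinf_ne hQ0 hQ1 hs0 hs1
  have hb := hO Q hQ0 hQ1 id (fun m => le_rfl)
  have ha := hO s hs0 hs1 id (fun m => le_rfl)
  have ha2 := hO s hs0 hs1 (fun m => 2 * m) (fun m => by omega)
  have ha3 := hO s hs0 hs1 (fun m => 2 * m + 1) (fun m => by omega)
  have h := hmul _ _ _ _ (hmul _ _ _ _ (hmul _ _ _ _ hb hb) (hmul _ _ _ _ ha ha))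
    (hinv _ _ (mul_ne_zero hne hne) (hmul _ _ _ _ ha2 ha3))
  refine h.congr_left fun m => ?_
  simp only [lqt, id]
  field_simp

lemma lqt_bounds (hQ0 : 0 < Q) (hQ1 : Q < 1) (hs0 : 0 < s) (hs1 : s < 1) :
    ∃ a b C : ℝ, 0 < a ∧ 0 < b ∧ 0 < C ∧ ∀ m, a ≤ lqt Q s m ∧ lqt Q s m ≤ b ∧
      |lqt Q s m - lqPinf Q Q ^ 2| ≤ C * Q ^ m := by
  obtain ⟨C, hC, h⟩ := bound_of_isBigO_nat_atTop (lqt_O hQ0 hQ1 hs0 hs1)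
  have hC' : ∀ m, |lqt Q s m - lqPinf Q Q ^ 2| ≤ C * Q ^ m := by
    intro m
    have := h (x := m) (by positivity)
    rwa [Real.norm_eq_abs, Real.norm_of_nonneg (by positivity)] at this
  have hQt : Tendsto (fun m : ℕ => Q ^ m) atTop (𝓝 0) := tendsto_pow_atTop_nhds_zero_of_lt_one hQ0.le hQ1
  have ht : Tendsto (lqt Q s) atTop (𝓝 (lqPinf Q Q ^ 2)) := by
    have := ((lqt_O hQ0 hQ1 hs0 hs1).trans_tendsto hQt).add_const (lqPinf Q Q ^ 2)
    simpa using this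
  have hL : lqPinf Q Q ^ 2 ≠ 0 := pow_ne_zero _ (lqPinf_ne hQ0 hQ1 hQ0 hQ1)
  obtain ⟨b, hb⟩ := ht.bddAbove_range
  obtain ⟨b', hb'⟩ := (ht.inv₀ hL).bddAbove_range
  have hb1 : ∀ m, lqt Q s m ≤ b := fun m => hb ⟨m, rfl⟩
  have hb2 : ∀ m, (lqt Q s m)⁻¹ ≤ b' := fun m => hb' ⟨m, rfl⟩
  have hp := lqt_pos hQ0 hQ1 hs0 hs1
  have hb'0 : 0 < b' := lt_of_lt_of_le (inv_pos.2 (hp 0)) (hb2 0)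
  refine ⟨b'⁻¹, b, C, inv_pos.2 hb'0, (hp 0).trans_le (hb1 0), hC, fun m => ⟨?_, hb1 m, hC' m⟩⟩
  rw [inv_le_comm₀ hb'0 (hp m)]
  exact hb2 m

lemma lqAC_bound (hQ0 : 0 < Q) (hQ1 : Q < 1) (hs0 : 0 < s) (hs1 : s < 1) (m : ℕ) :
    (0 ≤ lqA Q s m ∧ lqA Q s m ≤ ((1 - s) ^ 2)⁻¹ * Q ^ m) ∧
    (0 ≤ lqC Q s m ∧ lqC Q s m ≤ ((1 - s) ^ 2)⁻¹ * Q ^ m) := by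
  have hp := one_sub_pos_aux hQ0 hQ1 hs0 hs1
  have hle : ∀ j : ℕ, 1 - s ≤ 1 - s * Q ^ j := by
    intro j
    have : Q ^ j ≤ 1 := pow_le_one₀ hQ0.le hQ1.le
    nlinarith
  have hs : 0 < 1 - s := by linarith
  have hden : ∀ i j : ℕ, (1 - s) ^ 2 ≤ (1 - s * Q ^ i) * (1 - s * Q ^ j) := by
    intro i j
    rw [sq]
    exact mul_le_mul (hle i) (hle j) hs.le (hp i).le
  have hQm : 0 < Q ^ m := by positivity
  have hQm1 : Q ^ (m + 1) ≤ 1 := pow_le_one₀ hQ0.le hQ1.le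
  have hQm0 : 0 < Q ^ (m + 1) := by positivity
  have e0 := hp m
  have e1 := hp (2 * m)
  have e2 := hp (2 * m + 1)
  have e3 := hp (2 * m + 2)
  have q1 : (1 - s * Q ^ m) ^ 2 ≤ 1 := by
    have : 0 < s * Q ^ m := by positivity
    nlinarith
  have q2 : (1 - Q ^ (m + 1)) ^ 2 ≤ 1 := by nlinarith
  refine ⟨⟨by unfold lqA; positivity, ?_⟩, ⟨by unfold lqC; positivity, ?_⟩⟩
  · unfold lqA
    rw [div_le_iff₀ (by positivity)]
    calc Q ^ m * (1 - s * Q ^ m) ^ 2 ≤ Q ^ m * 1 := by gcongr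
      _ = ((1 - s) ^ 2)⁻¹ * Q ^ m * (1 - s) ^ 2 := by field_simp
      _ ≤ _ := by
        have := hden (2 * m) (2 * m + 1)
        gcongr
  · unfold lqC
    rw [div_le_iff₀ (by positivity)]
    calc s * Q ^ m * (1 - Q ^ (m + 1)) ^ 2 ≤ 1 * Q ^ m * 1 := by gcongr
      _ = ((1 - s) ^ 2)⁻¹ * Q ^ m * (1 - s) ^ 2 := by field_simp
      _ ≤ _ := by
        have := hden (2 * m + 1) (2 * m + 2)
        gcongr

lemma lqH_pos (hQ0 : 0 < Q) (hQ1 : Q < 1) (hs0 : 0 < s) (hs1 : s < 1) (m : ℕ) :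
    0 < lqH Q s m := by
  rw [lqH_eq hQ0 hQ1 hs0 hs1]
  have := lqt_pos hQ0 hQ1 hs0 hs1 m
  positivity

lemma lqX_bound (hQ0 : 0 < Q) (hQ1 : Q < 1) (hs0 : 0 < s) (hs1 : s < 1) :
    ∃ K : ℝ, 0 < K ∧ ∀ m, lqJ Q s ((X * lq Q s (m + 1)) * (X * lq Q s (m + 1))) ≤
      K * Q ^ (2 * m) * lqH Q s (m + 1) := by
  obtain ⟨a, b, C₁, ha, hb, -, hab⟩ := lqt_bounds hQ0 hQ1 hs0 hs1
  set e := ((1 - s) ^ 2)⁻¹ with he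
  have hs : 0 < 1 - s := by linarith
  have he0 : 0 < e := by positivity
  refine ⟨3 * (b / a + (2 * e) ^ 2 + e ^ 4 * (b / (a * s))), by positivity, fun m => ?_⟩
  -- norm ratios
  have hH : ∀ k, lqH Q s (k + 1) * lqt Q s k = s * Q ^ (2 * k) * lqt Q s (k + 1) * lqH Q s k := by
    intro k
    rw [lqH_eq hQ0 hQ1 hs0 hs1, lqH_eq hQ0 hQ1 hs0 hs1]
    have : Q ^ k ≠ 0 := by positivity
    rw [show (k + 1) * (k + 1) = k * k + 2 * k + 1 by ring]
    simp only [pow_add, pow_one]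
    field_simp
  have hHp := lqH_pos hQ0 hQ1 hs0 hs1
  have htp := lqt_pos hQ0 hQ1 hs0 hs1
  have hQ2 : 0 < Q ^ (2 * m) := by positivity
  have hup : lqH Q s (m + 2) ≤ b / a * Q ^ (2 * m) * lqH Q s (m + 1) := by
    have h := hH (m + 1)
    rw [div_mul_eq_mul_div, div_mul_eq_mul_div, le_div_iff₀ ha]
    calc lqH Q s (m + 2) * a ≤ lqH Q s (m + 2) * lqt Q s (m + 1) := by
          have := hHp (m + 2); gcongr; exact (hab _).1
      _ = s * Q ^ (2 * (m + 1)) * lqt Q s (m + 2) * lqH Q s (m + 1) := h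
      _ ≤ 1 * Q ^ (2 * m) * b * lqH Q s (m + 1) := by
          have := hHp (m + 1)
          have := htp (m + 2)
          have h3 : Q ^ (2 * (m + 1)) ≤ Q ^ (2 * m) := pow_le_pow_of_le_one hQ0.le hQ1.le (by omega)
          have := (hab (m + 2)).2.1
          gcongr
      _ = _ := by ring
  have hdn : Q ^ (2 * m) * lqH Q s m ≤ b / (a * s) * lqH Q s (m + 1) := by
    have h := hH m
    rw [div_mul_eq_mul_div, le_div_iff₀ (by positivity)]
    calc Q ^ (2 * m) * lqH Q s m * (a * s) = s * Q ^ (2 * m) * a * lqH Q s m := by ring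
      _ ≤ s * Q ^ (2 * m) * lqt Q s (m + 1) * lqH Q s m := by
          have := hHp m
          have := (hab (m + 1)).1
          gcongr
      _ = lqH Q s (m + 1) * lqt Q s m := h.symm
      _ ≤ lqH Q s (m + 1) * b := by
          have := hHp (m + 1); gcongr; exact (hab _).2.1
      _ = _ := by ring
  set B := lqA Q s (m + 1) + lqC Q s m with hB
  set Λ := lqA Q s m * lqC Q s m with hΛ
  have hA1 := (lqAC_bound hQ0 hQ1 hs0 hs1 (m + 1)).1
  have hA0 := (lqAC_bound hQ0 hQ1 hs0 hs1 m).1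
  have hC0 := (lqAC_bound hQ0 hQ1 hs0 hs1 m).2
  have hBb : B ^ 2 ≤ (2 * e) ^ 2 * Q ^ (2 * m) := by
    have h3 : Q ^ (m + 1) ≤ Q ^ m := pow_le_pow_of_le_one hQ0.le hQ1.le (by omega)
    have h4 : B ≤ 2 * e * Q ^ m := by
      have : e * Q ^ (m + 1) ≤ e * Q ^ m := by gcongr
      linarith [hA1.2, hC0.2]
    have h5 : 0 ≤ B := add_nonneg hA1.1 hC0.1
    calc B ^ 2 ≤ (2 * e * Q ^ m) ^ 2 := by gcongr
      _ = _ := by ring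
  have hΛb : Λ ^ 2 ≤ e ^ 4 * Q ^ (2 * m) * Q ^ (2 * m) := by
    have h4 : Λ ≤ (e * Q ^ m) * (e * Q ^ m) := mul_le_mul hA0.2 hC0.2 hC0.1 (by positivity)
    have h5 : 0 ≤ Λ := mul_nonneg hA0.1 hC0.1
    calc Λ ^ 2 ≤ ((e * Q ^ m) * (e * Q ^ m)) ^ 2 := by gcongr
      _ = _ := by ring
  have hrec : X * lq Q s (m + 1) = lq Q s (m + 2) + C B * lq Q s (m + 1) + C Λ * lq Q s m := by
    rw [lq]; ring
  have hJ : lqJ Q s ((X * lq Q s (m + 1)) * (X * lq Q s (m + 1))) ≤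
      lqJ Q s (C 3 * (lq Q s (m + 2) * lq Q s (m + 2) + C (B ^ 2) * (lq Q s (m + 1) * lq Q s (m + 1)) +
        C (Λ ^ 2) * (lq Q s m * lq Q s m))) := by
    refine Summable.tsum_le_tsum ?_ (lq_summable hQ0 hQ1 hs0 hs1 _) (lq_summable hQ0 hQ1 hs0 hs1 _)
    intro k
    apply mul_le_mul_of_nonneg_left _ (by positivity)
    rw [hrec]
    simp only [eval_mul, eval_add, eval_C]
    generalize eval (Q ^ k) (lq Q s (m + 2)) = u
    generalize eval (Q ^ k) (lq Q s (m + 1)) = v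
    generalize eval (Q ^ k) (lq Q s m) = y
    nlinarith [sq_nonneg (u - B * v), sq_nonneg (u - Λ * y), sq_nonneg (B * v - Λ * y)]
  refine hJ.trans ?_
  rw [lqJ_C_mul, lqJ_add hQ0 hQ1 hs0 hs1, lqJ_add hQ0 hQ1 hs0 hs1, lqJ_C_mul, lqJ_C_mul]
  change 3 * (lqH Q s (m + 2) + B ^ 2 * lqH Q s (m + 1) + Λ ^ 2 * lqH Q s m) ≤ _
  have h1 : B ^ 2 * lqH Q s (m + 1) ≤ (2 * e) ^ 2 * Q ^ (2 * m) * lqH Q s (m + 1) := by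
    have := hHp (m + 1)
    gcongr
  have h2 : Λ ^ 2 * lqH Q s m ≤ e ^ 4 * Q ^ (2 * m) * (b / (a * s) * lqH Q s (m + 1)) := by
    calc Λ ^ 2 * lqH Q s m ≤ e ^ 4 * Q ^ (2 * m) * Q ^ (2 * m) * lqH Q s m := by
          have := hHp m
          gcongr
      _ = e ^ 4 * Q ^ (2 * m) * (Q ^ (2 * m) * lqH Q s m) := by ring
      _ ≤ _ := by gcongr
  nlinarith [h1, h2, hup]
end


section
variable {ι : Type*}

/-- bounded -/
def BdF (f : ι → ℂ) : Prop := ∃ K : ℝ, ∀ i, ‖f i‖ ≤ K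

lemma BdF.mul {f g : ι → ℂ} (hf : BdF f) (hg : BdF g) : BdF (fun i => f i * g i) := by
  obtain ⟨K, hK⟩ := hf
  obtain ⟨L, hL⟩ := hg
  refine ⟨K * L, fun i => ?_⟩
  rw [norm_mul]
  exact mul_le_mul (hK i) (hL i) (norm_nonneg _) ((norm_nonneg _).trans (hK i))

lemma BdF.add {f g : ι → ℂ} (hf : BdF f) (hg : BdF g) : BdF (fun i => f i + g i) := by
  obtain ⟨K, hK⟩ := hf
  obtain ⟨L, hL⟩ := hg
  exact ⟨K + L, fun i => (norm_add_le _ _).trans (add_le_add (hK i) (hL i))⟩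

lemma BdF.sub {f g : ι → ℂ} (hf : BdF f) (hg : BdF g) : BdF (fun i => f i - g i) := by
  obtain ⟨K, hK⟩ := hf
  obtain ⟨L, hL⟩ := hg
  exact ⟨K + L, fun i => (norm_sub_le _ _).trans (add_le_add (hK i) (hL i))⟩

lemma BdF.const (c : ℂ) : BdF (fun _ : ι => c) := ⟨‖c‖, fun _ => le_rfl⟩

lemma BdF.poly (z : ι → ℝ) (hz : ∀ i, |z i| ≤ 1) (p : ℂ[X]) : BdF (fun i => p.eval (z i : ℂ)) := by
  obtain ⟨K, hK⟩ := (isCompact_closedBall (0 : ℂ) 1).exists_bound_of_continuousOn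
    p.continuous.continuousOn
  exact ⟨K, fun i => hK _ (by simpa using hz i)⟩

/-- squared weighted norm -/
noncomputable def N2 (ρ : ι → ℝ) (f : ι → ℂ) : ℝ := ∑' i, ‖f i‖ ^ 2 * ρ i

variable {ρ : ι → ℝ}

lemma BdF.summable (hρ : ∀ i, 0 < ρ i) (hs : Summable ρ) {f : ι → ℂ} (hf : BdF f) :
    Summable (fun i => f i * (ρ i : ℂ)) := by
  obtain ⟨K, hK⟩ := hf
  refine Summable.of_norm_bounded (hs.mul_left K) fun i => ?_
  rw [norm_mul, Complex.norm_real, Real.norm_of_nonneg (hρ i).le]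
  exact mul_le_mul_of_nonneg_right (hK i) (hρ i).le

lemma BdF.summable_sq (hρ : ∀ i, 0 < ρ i) (hs : Summable ρ) {f : ι → ℂ} (hf : BdF f) :
    Summable (fun i => ‖f i‖ ^ 2 * ρ i) := by
  have := ((hf.mul hf).summable hρ hs).norm
  refine this.congr fun i => ?_
  rw [norm_mul, norm_mul, Complex.norm_real, Real.norm_of_nonneg (hρ i).le, sq]

lemma N2_nonneg (hρ : ∀ i, 0 < ρ i) (f : ι → ℂ) : 0 ≤ N2 ρ f :=
  tsum_nonneg fun i => mul_nonneg (sq_nonneg _) (hρ i).le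

lemma N2_cs (hρ : ∀ i, 0 < ρ i) (hs : Summable ρ) {f g : ι → ℂ} (hf : BdF f) (hg : BdF g) :
    ‖∑' i, f i * g i * (ρ i : ℂ)‖ ≤ √(N2 ρ f) * √(N2 ρ g) := by
  have hn := ((hf.mul hg).summable hρ hs).norm
  have e : ∀ (h : ι → ℂ) i, (‖h i‖ * √(ρ i)) ^ (2 : ℝ) = ‖h i‖ ^ 2 * ρ i := by
    intro h i
    rw [Real.rpow_two, mul_pow, Real.sq_sqrt (hρ i).le]
  have h2 := Real.inner_le_Lp_mul_Lq_tsum_of_nonneg (f := fun i => ‖f i‖ * √(ρ i))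
    (g := fun i => ‖g i‖ * √(ρ i)) Real.HolderConjugate.two_two
    (fun i => by positivity) (fun i => by positivity)
    (by simp only [e]; exact hf.summable_sq hρ hs) (by simp only [e]; exact hg.summable_sq hρ hs)
  simp only [e] at h2
  rw [← Real.sqrt_eq_rpow, ← Real.sqrt_eq_rpow] at h2
  refine (norm_tsum_le_tsum_norm hn).trans (le_trans (le_of_eq ?_) h2)
  congr 1; ext i
  rw [norm_mul, norm_mul, Complex.norm_real, Real.norm_of_nonneg (hρ i).le]
  rw [show ‖f i‖ * √(ρ i) * (‖g i‖ * √(ρ i)) = ‖f i‖ * ‖g i‖ * (√(ρ i) * √(ρ i)) by ring,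
    Real.mul_self_sqrt (hρ i).le]

lemma N2_le (hρ : ∀ i, 0 < ρ i) (hs : Summable ρ) {f g : ι → ℂ} (hf : BdF f) (hg : BdF g) (C : ℝ)
    (h : ∀ i, ‖f i‖ ^ 2 ≤ C * ‖g i‖ ^ 2) : N2 ρ f ≤ C * N2 ρ g := by
  unfold N2
  rw [← tsum_mul_left]
  refine (hf.summable_sq hρ hs).tsum_le_tsum (fun i => ?_) ((hg.summable_sq hρ hs).mul_left C)
  rw [← mul_assoc]
  exact mul_le_mul_of_nonneg_right (h i) (hρ i).le

theorem pert (hρ : ∀ i, 0 < ρ i) (hs : Summable ρ) (z : ι → ℝ) (hz : ∀ i, |z i| ≤ 1)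
    (W : ι → ℂ) (c : ℝ) (hc : 0 ≤ c) (hW : ∀ i, ‖W i - 1‖ ≤ c * z i ^ 2)
    (n : ℕ) (P P0 : ℂ[X]) (hPm : P.Monic) (hPn : P.natDegree = n) (hP0m : P0.Monic)
    (hP0n : P0.natDegree = n) (γ : ℂ) (G δ D : ℝ) (hδ : 0 ≤ δ) (hD : 0 ≤ D)
    (hP : ∀ g : ℂ[X], g.degree < (n : WithBot ℕ) →
      ∑' i, P.eval (z i : ℂ) * g.eval (z i : ℂ) * W i * (ρ i : ℂ) = 0)
    (hPP : ∑' i, P.eval (z i : ℂ) * P.eval (z i : ℂ) * W i * (ρ i : ℂ) = γ)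
    (hP0 : ∀ g : ℂ[X], g.degree < (n : WithBot ℕ) →
      ∑' i, P0.eval (z i : ℂ) * g.eval (z i : ℂ) * (ρ i : ℂ) = 0)
    (hP00 : ∑' i, P0.eval (z i : ℂ) * P0.eval (z i : ℂ) * (ρ i : ℂ) = (G : ℂ))
    (hG : N2 ρ (fun i => P0.eval (z i : ℂ)) = G)
    (hX : N2 ρ (fun i => (z i : ℂ) ^ 2 * P0.eval (z i : ℂ)) ≤ δ ^ 2 * G)
    (htest : ∀ d : ℂ[X], d.degree < (n : WithBot ℕ) → ∃ p : ℂ[X], p.degree < (n : WithBot ℕ) ∧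
      (1 / 2) * N2 ρ (fun i => d.eval (z i : ℂ)) ≤
        ‖∑' i, d.eval (z i : ℂ) * p.eval (z i : ℂ) * W i * (ρ i : ℂ)‖ ∧
      N2 ρ (fun i => p.eval (z i : ℂ)) ≤ D ^ 2 * N2 ρ (fun i => d.eval (z i : ℂ))) :
    ‖γ - G‖ ≤ (c * δ + 2 * c ^ 2 * D * δ ^ 2) * G := by
  have hG0 : 0 ≤ G := hG ▸ N2_nonneg hρ _
  have bp := BdF.poly z hz
  have bW1 : BdF (fun i => W i - 1) := ⟨c, fun i => (hW i).trans (by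
    have : z i ^ 2 ≤ 1 := by rw [← sq_abs]; exact pow_le_one₀ (abs_nonneg _) (hz i)
    nlinarith)⟩
  have bW : BdF W := by simpa using bW1.add (BdF.const 1)
  set d := P - P0 with hd
  have hdd : d.degree < (n : WithBot ℕ) := by
    have h2 : P.degree = n := by rw [degree_eq_natDegree hPm.ne_zero, hPn]
    have h3 : P0.degree = n := by rw [degree_eq_natDegree hP0m.ne_zero, hP0n]
    rw [← h2]
    exact degree_sub_lt_left (by rw [h2, h3]) hPm.ne_zero
      (by rw [hPm.leadingCoeff, hP0m.leadingCoeff])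
  have hPe : ∀ i, P.eval (z i : ℂ) = P0.eval (z i : ℂ) + d.eval (z i : ℂ) := by
    intro i; simp [hd]
  set f : ι → ℂ := fun i => P0.eval (z i : ℂ) * (W i - 1) with hf
  have bf : BdF f := (bp P0).mul bW1
  have hNf : N2 ρ f ≤ (c * δ) ^ 2 * G := by
    have hX2 : BdF (fun i => (z i : ℂ) ^ 2 * P0.eval (z i : ℂ)) := by
      have := bp (X ^ 2 * P0)
      simpa using this
    calc N2 ρ f ≤ c ^ 2 * N2 ρ (fun i => (z i : ℂ) ^ 2 * P0.eval (z i : ℂ)) := by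
          refine N2_le hρ hs bf hX2 _ fun i => ?_
          simp only [hf]
          rw [norm_mul, norm_mul, norm_pow, Complex.norm_real, Real.norm_eq_abs, sq_abs]
          calc (‖P0.eval (z i : ℂ)‖ * ‖W i - 1‖) ^ 2 ≤ (‖P0.eval (z i : ℂ)‖ * (c * z i ^ 2)) ^ 2 := by
                gcongr; exact hW i
            _ = _ := by ring
      _ ≤ c ^ 2 * (δ ^ 2 * G) := by gcongr
      _ = _ := by ring
  have hsf : √(N2 ρ f) ≤ c * δ * √G := by
    rw [← Real.sqrt_sq (mul_nonneg hc hδ), ← Real.sqrt_mul (sq_nonneg _)]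
    exact Real.sqrt_le_sqrt hNf
  set y := √(N2 ρ (fun i => d.eval (z i : ℂ))) with hy
  have hy0 : 0 ≤ y := Real.sqrt_nonneg _
  have hyy : N2 ρ (fun i => d.eval (z i : ℂ)) = y ^ 2 := (Real.sq_sqrt (N2_nonneg hρ _)).symm
  have hyb : y ≤ 2 * c * D * δ * √G := by
    obtain ⟨p, hpd, hp1, hp2⟩ := htest d hdd
    have e1 : ∑' i, d.eval (z i : ℂ) * p.eval (z i : ℂ) * W i * (ρ i : ℂ) =
        -∑' i, f i * p.eval (z i : ℂ) * (ρ i : ℂ) := by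
      have a1 := hP p hpd
      have a2 := hP0 p hpd
      have s1 := (((bp d).mul (bp p)).mul bW).summable hρ hs
      have s2 := (bf.mul (bp p)).summable hρ hs
      have s3 := ((bp P0).mul (bp p)).summable hρ hs
      have : ∑' i, P.eval (z i : ℂ) * p.eval (z i : ℂ) * W i * (ρ i : ℂ) =
          ∑' i, d.eval (z i : ℂ) * p.eval (z i : ℂ) * W i * (ρ i : ℂ) +
          ∑' i, f i * p.eval (z i : ℂ) * (ρ i : ℂ) +
          ∑' i, P0.eval (z i : ℂ) * p.eval (z i : ℂ) * (ρ i : ℂ) := by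
        rw [← s1.tsum_add s2, ← (s1.add s2).tsum_add s3]
        congr 1; ext i
        rw [hPe]; simp only [hf]; ring
      rw [a1, a2] at this
      linear_combination -this
    rw [e1, norm_neg, hyy] at hp1
    have h3 := N2_cs hρ hs bf (bp p)
    have h4 : √(N2 ρ (fun i => p.eval (z i : ℂ))) ≤ D * y := by
      rw [hy, ← Real.sqrt_sq hD, ← Real.sqrt_mul (sq_nonneg _)]
      exact Real.sqrt_le_sqrt hp2
    have h5 : (1 / 2) * y ^ 2 ≤ (c * δ * √G) * (D * y) :=
      hp1.trans (h3.trans (mul_le_mul hsf h4 (Real.sqrt_nonneg _) (by positivity)))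
    by_cases hy1 : y = 0
    · rw [hy1]; positivity
    · have : 0 < y := lt_of_le_of_ne hy0 (Ne.symm hy1)
      have h6 : (1 / 2) * y ≤ c * δ * √G * D := by
        refine le_of_mul_le_mul_right ?_ this
        nlinarith
      nlinarith
  have e2 : γ - G = ∑' i, f i * P0.eval (z i : ℂ) * (ρ i : ℂ) +
      ∑' i, f i * d.eval (z i : ℂ) * (ρ i : ℂ) := by
    have a1 := hP d hdd
    have a2 := hP0 d hdd
    have s1 := (((bp P).mul (bp d)).mul bW).summable hρ hs
    have s2 := ((bp P0).mul (bp d)).summable hρ hs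
    have s3 := (bf.mul (bp P0)).summable hρ hs
    have s4 := (bf.mul (bp d)).summable hρ hs
    have s5 := ((bp P0).mul (bp P0)).summable hρ hs
    have : ∑' i, P.eval (z i : ℂ) * P.eval (z i : ℂ) * W i * (ρ i : ℂ) =
      ∑' i, P.eval (z i : ℂ) * d.eval (z i : ℂ) * W i * (ρ i : ℂ) +
      ∑' i, P0.eval (z i : ℂ) * d.eval (z i : ℂ) * (ρ i : ℂ) +
      ∑' i, f i * P0.eval (z i : ℂ) * (ρ i : ℂ) + ∑' i, f i * d.eval (z i : ℂ) * (ρ i : ℂ) +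
      ∑' i, P0.eval (z i : ℂ) * P0.eval (z i : ℂ) * (ρ i : ℂ) := by
      rw [← s1.tsum_add s2, ← (s1.add s2).tsum_add s3, ← ((s1.add s2).add s3).tsum_add s4,
        ← (((s1.add s2).add s3).add s4).tsum_add s5]
      congr 1; ext i
      rw [hPe]; simp only [hf]; ring
    rw [hPP, a1, a2, hP00] at this
    rw [this]; ring
  rw [e2]
  refine (norm_add_le _ _).trans ?_
  have h1 := N2_cs hρ hs bf (bp P0)
  have h2 := N2_cs hρ hs bf (bp d)
  rw [hG] at h1
  rw [← hy] at h2
  have hGG : √G * √G = G := Real.mul_self_sqrt hG0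
  have h1' : √(N2 ρ f) * √G ≤ c * δ * √G * √G := by gcongr
  have h2' : √(N2 ρ f) * y ≤ (c * δ * √G) * (2 * c * D * δ * √G) := by gcongr
  calc _ ≤ c * δ * √G * √G + (c * δ * √G) * (2 * c * D * δ * √G) := add_le_add (h1.trans h1') (h2.trans h2')
    _ = (c * δ + 2 * c ^ 2 * D * δ ^ 2) * (√G * √G) := by ring
    _ = _ := by rw [hGG]
end


section
variable {ι : Type*} {ρ : ι → ℝ}

theorem test_exists [DecidableEq ι] (hρ : ∀ i, 0 < ρ i) (hs : Summable ρ) (z : ι → ℝ) (hz : ∀ i, |z i| ≤ 1)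
    (W : ι → ℂ) (bW : BdF W) (F : Finset ι) (hWF : ∀ i ∈ F, W i ≠ 0)
    (hWn : ∀ i, i ∉ F → ‖W i - 1‖ ≤ 1 / 4)
    (hinj : Set.InjOn z F) (hz0 : ∀ i ∈ F, z i ≠ 0) (θ : ℝ) (hθ0 : 0 ≤ θ) (hθ : θ < 1)
    (hsep : ∀ a ∈ F, ∀ i, i ∉ F → |z i| ≤ θ * |z a|) :
    ∃ D : ℝ, 0 ≤ D ∧ ∃ n1 : ℕ, ∀ n ≥ n1, ∀ d : ℂ[X], d.degree < (n : WithBot ℕ) →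
      ∃ p : ℂ[X], p.degree < (n : WithBot ℕ) ∧
      (1 / 2) * N2 ρ (fun i => d.eval (z i : ℂ)) ≤
        ‖∑' i, d.eval (z i : ℂ) * p.eval (z i : ℂ) * W i * (ρ i : ℂ)‖ ∧
      N2 ρ (fun i => p.eval (z i : ℂ)) ≤ D ^ 2 * N2 ρ (fun i => d.eval (z i : ℂ)) := by
  have bp := BdF.poly z hz
  set zc : ι → ℂ := fun i => (z i : ℂ) with hzc
  have hinjc : Set.InjOn zc F := fun a ha b hb h => hinj ha hb (by simpa [hzc] using h)
  set S := ∑' i, ρ i with hS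
  have hS0 : 0 ≤ S := tsum_nonneg fun i => (hρ i).le
  -- bounds for the Lagrange basis
  have hM : ∃ M : ι → ℝ, ∀ a i, ‖(Lagrange.basis F zc a).eval (zc i)‖ ≤ M a := by
    choose M hM using fun a => bp (Lagrange.basis F zc a)
    exact ⟨M, hM⟩
  obtain ⟨M, hM⟩ := hM
  set K := ∑ a ∈ F, ‖(W a)⁻¹ - 1‖ * M a / √(ρ a) with hK
  obtain ⟨η, hη0, hη⟩ : ∃ η : ℝ, 0 < η ∧ 25 * η ^ 2 * S ≤ 1 := by
    refine ⟨1 / (5 * (1 + S)), by positivity, ?_⟩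
    rw [div_pow, mul_pow]
    have : 0 < 1 + S := by positivity
    field_simp
    nlinarith
  obtain ⟨L, hL⟩ : ∃ L : ℕ, θ ^ L * K ≤ η := by
    have h := (tendsto_pow_atTop_nhds_zero_of_lt_one hθ0 hθ).mul_const K
    rw [zero_mul] at h
    obtain ⟨L, hL⟩ := (h.eventually (gt_mem_nhds hη0)).exists
    exact ⟨L, hL.le⟩
  obtain ⟨κ, hκ⟩ : ∃ κ : ℝ, ∀ i ∈ F, ‖(W i)⁻¹‖ ≤ κ :=
    ⟨∑ i ∈ F, ‖(W i)⁻¹‖, fun i hi => Finset.single_le_sum (f := fun i => ‖(W i)⁻¹‖)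
      (fun _ _ => norm_nonneg _) hi⟩
  refine ⟨√(κ ^ 2 + 2 + 2 * η ^ 2 * S), Real.sqrt_nonneg _, L + F.card + 1, fun n hn d hd => ?_⟩
  rw [Real.sq_sqrt (by positivity)]
  set Nd := N2 ρ (fun i => d.eval (zc i)) with hNd
  have hNd0 : 0 ≤ Nd := N2_nonneg hρ _
  set e : ι → ℂ[X] := fun a => C ((zc a ^ L)⁻¹) * (X ^ L * Lagrange.basis F zc a) with he
  set k : ι → ℂ := fun a => (starRingEnd ℂ) (d.eval (zc a)) * ((W a)⁻¹ - 1) with hk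
  set r : ℂ[X] := ∑ a ∈ F, C (k a) * e a with hr
  set p : ℂ[X] := d.map (starRingEnd ℂ) + r with hp
  have hconj : ∀ i, (d.map (starRingEnd ℂ)).eval (zc i) = (starRingEnd ℂ) (d.eval (zc i)) := by
    intro i
    have : zc i = (starRingEnd ℂ) (zc i) := by simp [hzc]
    rw [eval_map]
    conv_lhs => rw [this]
    rw [eval₂_at_apply]
  have hre : ∀ i, r.eval (zc i) = ∑ a ∈ F, k a * ((zc a ^ L)⁻¹ * (zc i ^ L * (Lagrange.basis F zc a).eval (zc i))) := by
    intro i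
    simp [hr, he, eval_finset_sum]
  have hrF : ∀ i ∈ F, r.eval (zc i) = k i := by
    intro i hi
    rw [hre, Finset.sum_eq_single i]
    · rw [Lagrange.eval_basis_self hinjc hi]
      have : zc i ^ L ≠ 0 := pow_ne_zero _ (by simpa [hzc] using hz0 i hi)
      field_simp
    · intro b hb hbi
      rw [Lagrange.eval_basis_of_ne hbi hi]; simp
    · intro h; exact absurd hi h
  have hpt : ∀ a, ‖d.eval (zc a)‖ ≤ √Nd / √(ρ a) := by
    intro a
    have h1 : ‖d.eval (zc a)‖ ^ 2 * ρ a ≤ Nd :=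
      ((bp d).summable_sq hρ hs).le_tsum a (fun i _ => mul_nonneg (sq_nonneg _) (hρ i).le)
    rw [le_div_iff₀ (Real.sqrt_pos.2 (hρ a))]
    apply Real.le_sqrt_of_sq_le
    rw [mul_pow, Real.sq_sqrt (hρ a).le]
    exact h1
  have hrn : ∀ i, i ∉ F → ‖r.eval (zc i)‖ ≤ η * √Nd := by
    intro i hi
    rw [hre]
    calc _ ≤ ∑ a ∈ F, ‖k a * ((zc a ^ L)⁻¹ * (zc i ^ L * (Lagrange.basis F zc a).eval (zc i)))‖ :=
          norm_sum_le _ _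
      _ ≤ ∑ a ∈ F, (θ ^ L * √Nd) * (‖(W a)⁻¹ - 1‖ * M a / √(ρ a)) := by
          refine Finset.sum_le_sum fun a ha => ?_
          have h1 : ‖(zc a ^ L)⁻¹‖ * ‖zc i ^ L‖ ≤ θ ^ L := by
            have hza : 0 < |z a| := abs_pos.2 (hz0 a ha)
            simp only [hzc, norm_inv, norm_pow, Complex.norm_real, Real.norm_eq_abs]
            rw [inv_mul_le_iff₀ (by positivity), ← mul_pow]
            refine pow_le_pow_left₀ (abs_nonneg _) ?_ L
            rw [mul_comm]; exact hsep a ha i hi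
          have hM0 : 0 ≤ M a := (norm_nonneg _).trans (hM a i)
          rw [norm_mul, norm_mul, norm_mul, norm_mul, RCLike.norm_conj]
          calc ‖d.eval (zc a)‖ * ‖(W a)⁻¹ - 1‖ * (‖(zc a ^ L)⁻¹‖ * (‖zc i ^ L‖ * ‖(Lagrange.basis F zc a).eval (zc i)‖))
              = ‖d.eval (zc a)‖ * ‖(W a)⁻¹ - 1‖ * ((‖(zc a ^ L)⁻¹‖ * ‖zc i ^ L‖) * ‖(Lagrange.basis F zc a).eval (zc i)‖) := by ring
            _ ≤ (√Nd / √(ρ a)) * ‖(W a)⁻¹ - 1‖ * (θ ^ L * M a) := by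
                have := hpt a
                have := hM a i
                gcongr
            _ = _ := by ring
      _ = (θ ^ L * K) * √Nd := by rw [← Finset.mul_sum, hK]; ring
      _ ≤ η * √Nd := by gcongr
  have hrn2 : ∀ i, i ∉ F → ‖r.eval (zc i)‖ ^ 2 ≤ η ^ 2 * Nd := by
    intro i hi
    calc ‖r.eval (zc i)‖ ^ 2 ≤ (η * √Nd) ^ 2 := by gcongr; exact hrn i hi
      _ = _ := by rw [mul_pow, Real.sq_sqrt hNd0]
  have hpe : ∀ i, p.eval (zc i) = (starRingEnd ℂ) (d.eval (zc i)) + r.eval (zc i) := by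
    intro i; rw [hp, eval_add, hconj]
  have hpF : ∀ i ∈ F, p.eval (zc i) = (starRingEnd ℂ) (d.eval (zc i)) * (W i)⁻¹ := by
    intro i hi; rw [hpe, hrF i hi, hk]; ring
  have hsq : Summable (fun i => ‖d.eval (zc i)‖ ^ 2 * ρ i) := (bp d).summable_sq hρ hs
  refine ⟨p, ?_, ?_, ?_⟩
  · rw [← mem_degreeLT, hp]
    refine Submodule.add_mem _ ?_ (Submodule.sum_mem _ fun a ha => ?_)
    · rw [mem_degreeLT]
      exact degree_map_le.trans_lt hd
    · rw [mem_degreeLT]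
      have h1 : (C (k a) * e a).natDegree ≤ L + F.card := by
        refine (natDegree_C_mul_le _ _).trans ((natDegree_C_mul_le _ _).trans (natDegree_mul_le.trans ?_))
        rw [natDegree_X_pow]
        have : (Lagrange.basis F zc a).natDegree = F.card - 1 :=
          natDegree_eq_of_degree_eq_some (Lagrange.degree_basis hinjc ha)
        omega
      refine degree_le_natDegree.trans_lt ?_
      exact_mod_cast (by omega : (C (k a) * e a).natDegree < n)
  · have hsm := (((bp d).mul (bp p)).mul bW).summable hρ hs
    have hre' := (Complex.reCLM.hasSum hsm.hasSum)
    refine le_trans ?_ (Complex.re_le_norm _)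
    have hlow : HasSum (fun i => (5 / 8 * (‖d.eval (zc i)‖ ^ 2 * ρ i) - 25 / 8 * (η ^ 2 * Nd) * ρ i))
        (5 / 8 * Nd - 25 / 8 * (η ^ 2 * Nd) * S) :=
      (hsq.hasSum.mul_left _).sub (hs.hasSum.mul_left _)
    have hcmp := hasSum_le (fun i => ?_) hlow hre'
    · refine le_trans ?_ hcmp
      nlinarith
    · simp only [Complex.reCLM_apply, Function.comp]
      rw [Complex.re_mul_ofReal]
      rw [show 5 / 8 * (‖d.eval (zc i)‖ ^ 2 * ρ i) - 25 / 8 * (η ^ 2 * Nd) * ρ i =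
        (5 / 8 * ‖d.eval (zc i)‖ ^ 2 - 25 / 8 * (η ^ 2 * Nd)) * ρ i by ring]
      refine mul_le_mul_of_nonneg_right ?_ (hρ i).le
      by_cases hi : i ∈ F
      · change _ ≤ (d.eval (zc i) * p.eval (zc i) * W i).re
        rw [hpF i hi]
        have : d.eval (zc i) * ((starRingEnd ℂ) (d.eval (zc i)) * (W i)⁻¹) * W i = ((‖d.eval (zc i)‖ ^ 2 : ℝ) : ℂ) := by
          have hw := hWF i hi
          rw [show d.eval (zc i) * ((starRingEnd ℂ) (d.eval (zc i)) * (W i)⁻¹) * W i =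
            d.eval (zc i) * (starRingEnd ℂ) (d.eval (zc i)) * ((W i)⁻¹ * W i) by ring,
            inv_mul_cancel₀ hw, mul_one, Complex.mul_conj, Complex.normSq_eq_norm_sq]
        rw [this, Complex.ofReal_re]
        have : 0 ≤ η ^ 2 * Nd := by positivity
        nlinarith [sq_nonneg ‖d.eval (zc i)‖]
      · change _ ≤ (d.eval (zc i) * p.eval (zc i) * W i).re
        have hr2 := hrn2 i hi
        rw [hpe]
        generalize d.eval (zc i) = x at *
        generalize r.eval (zc i) = y at *
        have hw := hWn i hi
        have e1 : x * ((starRingEnd ℂ) x + y) * W i =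
            ((‖x‖ ^ 2 : ℝ) : ℂ) + (((‖x‖ ^ 2 : ℝ) : ℂ) * (W i - 1) + x * y * W i) := by
          have : x * (starRingEnd ℂ) x = ((‖x‖ ^ 2 : ℝ) : ℂ) := by
            rw [Complex.mul_conj, Complex.normSq_eq_norm_sq]
          rw [← this]; ring
        rw [e1, Complex.add_re, Complex.ofReal_re]
        have hw2 : ‖W i‖ ≤ 5 / 4 := by
          calc ‖W i‖ = ‖(W i - 1) + 1‖ := by ring_nf
            _ ≤ ‖W i - 1‖ + ‖(1 : ℂ)‖ := norm_add_le _ _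
            _ ≤ _ := by rw [norm_one]; linarith
        have e2 : ‖((‖x‖ ^ 2 : ℝ) : ℂ) * (W i - 1) + x * y * W i‖ ≤ ‖x‖ ^ 2 * (1 / 4) + ‖x‖ * ‖y‖ * (5 / 4) := by
          refine (norm_add_le _ _).trans (add_le_add ?_ ?_)
          · rw [norm_mul, Complex.norm_real, Real.norm_of_nonneg (by positivity)]
            gcongr
          · rw [norm_mul, norm_mul]
            gcongr
        have e3 := (abs_le.1 ((Complex.abs_re_le_norm _).trans e2)).1
        nlinarith [sq_nonneg (‖x‖ - 5 * ‖y‖)]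
  · have hup : ∀ i, ‖p.eval (zc i)‖ ^ 2 ≤ (κ ^ 2 + 2) * ‖d.eval (zc i)‖ ^ 2 + 2 * η ^ 2 * Nd := by
      intro i
      by_cases hi : i ∈ F
      · rw [hpF i hi, norm_mul, RCLike.norm_conj, mul_pow]
        have h1 : ‖(W i)⁻¹‖ ^ 2 ≤ κ ^ 2 := by gcongr; exact hκ i hi
        have : 0 ≤ η ^ 2 * Nd := by positivity
        nlinarith [sq_nonneg ‖d.eval (zc i)‖]
      · rw [hpe]
        have h1 := norm_add_le ((starRingEnd ℂ) (d.eval (zc i))) (r.eval (zc i))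
        rw [RCLike.norm_conj] at h1
        have h2 := hrn2 i hi
        have h3 : ‖(starRingEnd ℂ) (d.eval (zc i)) + r.eval (zc i)‖ ^ 2 ≤ (‖d.eval (zc i)‖ + ‖r.eval (zc i)‖) ^ 2 := by
          gcongr
        nlinarith [sq_nonneg (‖d.eval (zc i)‖ - ‖r.eval (zc i)‖), sq_nonneg (κ * ‖d.eval (zc i)‖)]
    have hh : HasSum (fun i => ((κ ^ 2 + 2) * (‖d.eval (zc i)‖ ^ 2 * ρ i) + (2 * η ^ 2 * Nd) * ρ i))
        ((κ ^ 2 + 2) * Nd + (2 * η ^ 2 * Nd) * S) :=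
      (hsq.hasSum.mul_left _).add (hs.hasSum.mul_left _)
    have := hasSum_le (fun i => ?_) ((bp p).summable_sq hρ hs).hasSum hh
    · refine this.trans (le_of_eq (by ring))
    · have h1 := mul_le_mul_of_nonneg_right (hup i) (hρ i).le
      refine h1.trans (le_of_eq (by ring))
end


noncomputable def nz (q : ℝ) : ℕ ⊕ ℕ → ℝ := Sum.elim (fun k => q ^ k) (fun k => -q ^ k)
noncomputable def nρ (s : ℝ) : ℕ ⊕ ℕ → ℝ := Sum.elim (fun k => s ^ k) (fun k => s ^ k)

section
variable {q s : ℝ}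

lemma nz_abs (hq0 : 0 < q) (hq1 : q < 1) (i : ℕ ⊕ ℕ) : |nz q i| ≤ 1 := by
  rcases i with k | k
  · simp only [nz, Sum.elim_inl, abs_pow, abs_of_pos hq0]
    exact pow_le_one₀ hq0.le hq1.le
  · simp only [nz, Sum.elim_inr, abs_neg, abs_pow, abs_of_pos hq0]
    exact pow_le_one₀ hq0.le hq1.le

lemma nρ_pos (hs0 : 0 < s) (i : ℕ ⊕ ℕ) : 0 < nρ s i := by
  rcases i with k | k
  · simp only [nρ, Sum.elim_inl]; positivity
  · simp only [nρ, Sum.elim_inr]; positivity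

lemma nρ_summable (hs0 : 0 < s) (hs1 : s < 1) : Summable (nρ s) := by
  have h := summable_geometric_of_lt_one hs0.le hs1
  exact Summable.sum _ h h

lemma mul_pow_lt_one_aux (hq0 : 0 < q) (hq1 : q < 1) (hs0 : 0 < s) (hs1 : s < 1) (e : ℕ) :
    s * q ^ e < 1 := by
  have : q ^ e ≤ 1 := pow_le_one₀ hq0.le hq1.le
  nlinarith [pow_pos hq0 e]

lemma nsum_even (hq0 : 0 < q) (hq1 : q < 1) (hs0 : 0 < s) (hs1 : s < 1) (e : ℕ) (p : ℝ[X]) :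
    HasSum (fun i => nz q i ^ (2 * e) * p.eval (nz q i ^ 2) * nρ s i)
      (2 * lqJ (q ^ 2) (s * (q ^ 2) ^ e) p) := by
  have hQ0 : 0 < q ^ 2 := by positivity
  have hQ1 : q ^ 2 < 1 := pow_lt_one₀ hq0.le hq1 (by norm_num)
  have h := (lq_summable hQ0 hQ1 (s := s * (q ^ 2) ^ e) (by positivity)
    (mul_pow_lt_one_aux hQ0 hQ1 hs0 hs1 e) p).hasSum
  rw [two_mul (lqJ _ _ _)]
  refine HasSum.sum ?_ ?_
  · refine h.congr_fun ?_ |> fun h => h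
    intro k
    simp only [Function.comp, nz, nρ, Sum.elim_inl]
    rw [← pow_mul, ← pow_mul, mul_comm k 2, pow_mul q 2 k]
    rw [mul_pow]; ring
  · refine h.congr_fun ?_ |> fun h => h
    intro k
    simp only [Function.comp, nz, nρ, Sum.elim_inr]
    rw [pow_mul (-q ^ k), neg_sq, ← pow_mul q k 2, mul_comm k 2, pow_mul q 2 k]
    rw [mul_pow]; ring

lemma nsum_odd (hq0 : 0 < q) (hq1 : q < 1) (hs0 : 0 < s) (hs1 : s < 1) (l : ℕ) (p : ℝ[X]) :
    HasSum (fun i => nz q i ^ (2 * l + 1) * p.eval (nz q i ^ 2) * nρ s i) 0 := by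
  have hQ0 : 0 < q ^ 2 := by positivity
  have hQ1 : q ^ 2 < 1 := pow_lt_one₀ hq0.le hq1 (by norm_num)
  have h := (lq_summable hQ0 hQ1 (s := s * q ^ (2 * l + 1)) (by positivity)
    (mul_pow_lt_one_aux hq0 hq1 hs0 hs1 _) p).hasSum
  rw [← add_neg_cancel (∑' k, (s * q ^ (2 * l + 1)) ^ k * p.eval ((q ^ 2) ^ k))]
  refine HasSum.sum ?_ ?_
  · refine h.congr_fun ?_ |> fun h => h
    intro k
    simp only [Function.comp, nz, nρ, Sum.elim_inl]
    rw [← pow_mul q k 2, mul_comm k 2, pow_mul q 2 k]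
    rw [mul_pow]; ring
  · refine h.neg.congr_fun ?_ |> fun h => h
    intro k
    simp only [Function.comp, nz, nρ, Sum.elim_inr]
    rw [neg_sq, Odd.neg_pow ⟨l, rfl⟩, ← pow_mul q k 2, mul_comm k 2, pow_mul q 2 k]
    rw [mul_pow]; ring

/-- unperturbed polynomial -/
noncomputable def P0 (Q s : ℝ) (e m : ℕ) : ℂ[X] :=
  (X ^ e * (lq Q (s * Q ^ e) m).comp (X ^ 2)).map Complex.ofRealHom

lemma P0_eval (Q s : ℝ) (e m : ℕ) (x : ℝ) :
    (P0 Q s e m).eval (x : ℂ) = ((x ^ e * (lq Q (s * Q ^ e) m).eval (x ^ 2) : ℝ) : ℂ) := by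
  unfold P0
  have := Polynomial.eval_map_apply (f := Complex.ofRealHom) (p := (X ^ e * (lq Q (s * Q ^ e) m).comp (X ^ 2))) x
  simp only [Complex.ofRealHom_eq_coe] at this
  rw [this]
  simp

lemma P0_monic (Q s : ℝ) (e m : ℕ) : (P0 Q s e m).Monic := by
  unfold P0
  refine Monic.map _ ((monic_X_pow e).mul ?_)
  exact (lq_monic m).1.comp (monic_X_pow 2) (by simp)

lemma P0_natDegree (Q s : ℝ) (e m : ℕ) : (P0 Q s e m).natDegree = 2 * m + e := by
  unfold P0
  rw [natDegree_map, (monic_X_pow e).natDegree_mul ((lq_monic m).1.comp (monic_X_pow 2) (by simp)),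
    natDegree_comp, (lq_monic m).2]
  simp; ring

lemma P0_orth_mono (hq0 : 0 < q) (hq1 : q < 1) (hs0 : 0 < s) (hs1 : s < 1) {e m : ℕ} (he : e ≤ 1)
    (i : ℕ) (hi : i < 2 * m + e) :
    HasSum (fun t => nz q t ^ e * (lq (q ^ 2) (s * (q ^ 2) ^ e) m).eval (nz q t ^ 2) * nz q t ^ i * nρ s t)
      0 := by
  rcases Nat.even_or_odd' (e + i) with ⟨l, hl | hl⟩
  · obtain ⟨j, rfl⟩ : ∃ j, i = e + 2 * j := ⟨l - e, by omega⟩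
    have h := nsum_even hq0 hq1 hs0 hs1 e (lq (q ^ 2) (s * (q ^ 2) ^ e) m * X ^ j)
    have hQ0 : 0 < q ^ 2 := by positivity
    have hQ1 : q ^ 2 < 1 := pow_lt_one₀ hq0.le hq1 (by norm_num)
    rw [lqJ_orth hQ0 hQ1 (by positivity) (mul_pow_lt_one_aux hQ0 hQ1 hs0 hs1 e) (by omega), mul_zero] at h
    refine h.congr_fun ?_ |> fun h => h
    intro t
    simp only [eval_mul, eval_pow, eval_X]
    ring
  · have h := nsum_odd hq0 hq1 hs0 hs1 l (lq (q ^ 2) (s * (q ^ 2) ^ e) m)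
    refine h.congr_fun ?_ |> fun h => h
    intro t
    rw [← hl]
    ring

lemma P0_orth (hq0 : 0 < q) (hq1 : q < 1) (hs0 : 0 < s) (hs1 : s < 1) {e m : ℕ} (he : e ≤ 1)
    (g : ℂ[X]) (hg : g.degree < ((2 * m + e : ℕ) : WithBot ℕ)) :
    ∑' t, (P0 (q ^ 2) s e m).eval (nz q t : ℂ) * g.eval (nz q t : ℂ) * (nρ s t : ℂ) = 0 := by
  have hn : g.natDegree < 2 * m + e ∨ g = 0 := by
    by_cases h : g = 0
    · exact Or.inr h
    · exact Or.inl ((natDegree_lt_iff_degree_lt h).2 hg)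
  rcases hn with hn | rfl
  swap
  · simp
  have h1 : HasSum (fun t => ∑ i ∈ Finset.range (2 * m + e), g.coeff i *
      ((nz q t ^ e * (lq (q ^ 2) (s * (q ^ 2) ^ e) m).eval (nz q t ^ 2) * nz q t ^ i * nρ s t : ℝ) : ℂ))
      (∑ i ∈ Finset.range (2 * m + e), g.coeff i * ((0 : ℝ) : ℂ)) := by
    refine hasSum_sum fun i hi => HasSum.mul_left _ ?_
    exact Complex.hasSum_ofReal.2 (P0_orth_mono hq0 hq1 hs0 hs1 he i (Finset.mem_range.1 hi))
  simp only [Complex.ofReal_zero, mul_zero, Finset.sum_const_zero] at h1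
  refine Eq.trans (tsum_congr fun t => ?_) h1.tsum_eq
  rw [P0_eval, eval_eq_sum_range' hn, Finset.mul_sum, Finset.sum_mul]
  refine Finset.sum_congr rfl fun i _ => ?_
  push_cast
  ring

lemma P0_sq_hasSum (hq0 : 0 < q) (hq1 : q < 1) (hs0 : 0 < s) (hs1 : s < 1) (e m : ℕ) :
    HasSum (fun t => (nz q t ^ e * (lq (q ^ 2) (s * (q ^ 2) ^ e) m).eval (nz q t ^ 2)) ^ 2 * nρ s t)
      (2 * lqH (q ^ 2) (s * (q ^ 2) ^ e) m) := by
  have h := nsum_even hq0 hq1 hs0 hs1 e (lq (q ^ 2) (s * (q ^ 2) ^ e) m * lq (q ^ 2) (s * (q ^ 2) ^ e) m)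
  refine h.congr_fun ?_ |> fun h => h
  intro t
  simp only [eval_mul]
  ring

lemma P0_sq (hq0 : 0 < q) (hq1 : q < 1) (hs0 : 0 < s) (hs1 : s < 1) (e m : ℕ) :
    ∑' t, (P0 (q ^ 2) s e m).eval (nz q t : ℂ) * (P0 (q ^ 2) s e m).eval (nz q t : ℂ) * (nρ s t : ℂ)
      = ((2 * lqH (q ^ 2) (s * (q ^ 2) ^ e) m : ℝ) : ℂ) := by
  refine Eq.trans (tsum_congr fun t => ?_) (Complex.hasSum_ofReal.2 (P0_sq_hasSum hq0 hq1 hs0 hs1 e m)).tsum_eq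
  rw [P0_eval]; push_cast; ring

lemma P0_N2 (hq0 : 0 < q) (hq1 : q < 1) (hs0 : 0 < s) (hs1 : s < 1) (e m : ℕ) :
    N2 (nρ s) (fun t => (P0 (q ^ 2) s e m).eval (nz q t : ℂ)) = 2 * lqH (q ^ 2) (s * (q ^ 2) ^ e) m := by
  refine Eq.trans (tsum_congr fun t => ?_) (P0_sq_hasSum hq0 hq1 hs0 hs1 e m).tsum_eq
  dsimp only
  rw [P0_eval, Complex.norm_real, Real.norm_eq_abs, sq_abs]

lemma P0_XN2 (hq0 : 0 < q) (hq1 : q < 1) (hs0 : 0 < s) (hs1 : s < 1) (e m : ℕ) :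
    N2 (nρ s) (fun t => (nz q t : ℂ) ^ 2 * (P0 (q ^ 2) s e m).eval (nz q t : ℂ)) =
      2 * lqJ (q ^ 2) (s * (q ^ 2) ^ e)
        ((X * lq (q ^ 2) (s * (q ^ 2) ^ e) m) * (X * lq (q ^ 2) (s * (q ^ 2) ^ e) m)) := by
  refine Eq.trans (tsum_congr fun t => ?_) (nsum_even hq0 hq1 hs0 hs1 e _).tsum_eq
  dsimp only
  rw [P0_eval, ← Complex.ofReal_pow, ← Complex.ofReal_mul, Complex.norm_real, Real.norm_eq_abs, sq_abs]
  simp only [eval_mul, eval_X]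
  ring

end


section
variable {q s : ℝ}

lemma orth_poly {ι : Type*} (x : ι → ℂ) (v : ι → ℂ) (P : ℕ → ℂ[X]) (hmonic : ∀ n, (P n).Monic)
    (hdeg : ∀ n, (P n).natDegree = n) (γ : ℕ → ℂ)
    (horth : ∀ n m : ℕ, HasSum (fun i => (P n).eval (x i) * (P m).eval (x i) * v i)
      (if n = m then γ n else 0)) (n : ℕ) :
    ∀ (k : ℕ) (_ : k ≤ n) (g : ℂ[X]) (_ : g.degree < (k : WithBot ℕ)),
      HasSum (fun i => (P n).eval (x i) * g.eval (x i) * v i) 0 := by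
  intro k
  induction k with
  | zero =>
    intro _ g hg
    have : g = 0 := by
      rw [← degree_eq_bot]
      simpa using hg
    subst this
    simp
  | succ k ih =>
    intro hk g hg
    have hPk : (P k).degree = k := by rw [degree_eq_natDegree (hmonic k).ne_zero, hdeg]
    have hg' : (g - C (g.coeff k) * P k).degree < (k : WithBot ℕ) := by
      rw [degree_lt_iff_coeff_zero]
      intro j hj
      rw [degree_lt_iff_coeff_zero] at hg
      rw [coeff_sub, coeff_C_mul]
      rcases hj.eq_or_lt with rfl | hj
      · have : (P k).coeff k = 1 := by
          have := (hmonic k).coeff_natDegree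
          rwa [hdeg] at this
        rw [this]; ring
      · rw [hg j hj, coeff_eq_zero_of_natDegree_lt (p := P k) (by rw [hdeg]; exact hj)]; ring
    have h1 := ih (by omega) _ hg'
    have h2 := (horth n k).mul_left (g.coeff k)
    rw [if_neg (by omega), mul_zero] at h2
    have h3 := h1.add h2
    rw [add_zero] at h3
    refine h3.congr_fun ?_ |> fun h => h
    intro i
    simp only [eval_sub, eval_mul, eval_C]
    ring

theorem main_eps (hq0 : 0 < q) (hq1 : q < 1) (hs0 : 0 < s) (hs1 : s < 1) (W : ℕ ⊕ ℕ → ℂ)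
    (c : ℝ) (hc : 0 ≤ c) (hW : ∀ i, ‖W i - 1‖ ≤ c * nz q i ^ 2) (hW0 : ∀ i, W i ≠ 0)
    (P : ℕ → ℂ[X]) (hmonic : ∀ n, (P n).Monic) (hdeg : ∀ n, (P n).natDegree = n) (γ : ℕ → ℂ)
    (horth : ∀ n m : ℕ, HasSum (fun i => (P n).eval (nz q i : ℂ) * (P m).eval (nz q i : ℂ) *
      (W i * (nρ s i : ℂ))) (if n = m then γ n else 0)) (e : ℕ) (he : e ≤ 1) :
    ∃ C : ℝ, 0 ≤ C ∧ ∃ M : ℕ, ∀ m ≥ M, ‖γ (2 * m + e) - ((2 * lqH (q ^ 2) (s * (q ^ 2) ^ e) m : ℝ) : ℂ)‖ ≤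
      C * (q ^ 2) ^ m * lqH (q ^ 2) (s * (q ^ 2) ^ e) m := by
  have hQ0 : 0 < q ^ 2 := by positivity
  have hQ1 : q ^ 2 < 1 := pow_lt_one₀ hq0.le hq1 (by norm_num)
  have hρ := nρ_pos hs0
  have hsum := nρ_summable hs0 hs1
  have hz := nz_abs hq0 hq1
  have hs'0 : 0 < s * (q ^ 2) ^ e := by positivity
  have hs'1 := mul_pow_lt_one_aux hQ0 hQ1 hs0 hs1 e
  obtain ⟨K, hK⟩ : ∃ K : ℕ, c * (q ^ 2) ^ K ≤ 1 / 4 := by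
    obtain ⟨K, hK⟩ := exists_pow_lt_of_lt_one (show (0 : ℝ) < 1 / (4 * (c + 1)) by positivity) hQ1
    refine ⟨K, ?_⟩
    rw [lt_div_iff₀ (by positivity)] at hK
    nlinarith [pow_pos hQ0 K]
  set F : Finset (ℕ ⊕ ℕ) := (Finset.range K).disjSum (Finset.range K) with hF
  have habs : ∀ i, |nz q i| = q ^ (Sum.elim id id i : ℕ) := by
    rintro (k | k)
    · simp [nz, abs_of_pos hq0]
    · simp [nz, abs_of_pos hq0]
  have hmemF : ∀ i, i ∈ F ↔ (Sum.elim id id i : ℕ) < K := by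
    rintro (k | k) <;> simp [hF]
  have bW : BdF W := by
    refine ⟨c + 1, fun i => ?_⟩
    have h1 : nz q i ^ 2 ≤ 1 := by rw [← sq_abs]; exact pow_le_one₀ (abs_nonneg _) (hz i)
    calc ‖W i‖ = ‖(W i - 1) + 1‖ := by ring_nf
      _ ≤ ‖W i - 1‖ + 1 := by simpa using norm_add_le (W i - 1) 1
      _ ≤ c + 1 := by nlinarith [hW i]
  obtain ⟨D, hD, n1, htest⟩ := test_exists hρ hsum (nz q) hz W bW F (fun i _ => hW0 i)
    (by
      intro i hi
      rw [hmemF, not_lt] at hi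
      refine (hW i).trans (le_trans ?_ hK)
      rw [← sq_abs, habs, ← pow_mul, mul_comm _ 2, pow_mul]
      exact mul_le_mul_of_nonneg_left (pow_le_pow_of_le_one hQ0.le hQ1.le hi) hc)
    (by
      have hinj : Function.Injective (fun k : ℕ => q ^ k) := pow_right_injective₀ hq0 hq1.ne
      rintro (k | k) _ (l | l) _ h
      · simp only [nz, Sum.elim_inl] at h
        rw [hinj h]
      · simp only [nz, Sum.elim_inl, Sum.elim_inr] at h
        nlinarith [pow_pos hq0 k, pow_pos hq0 l]
      · simp only [nz, Sum.elim_inl, Sum.elim_inr] at h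
        nlinarith [pow_pos hq0 k, pow_pos hq0 l]
      · simp only [nz, Sum.elim_inr, neg_inj] at h
        rw [hinj h])
    (by
      intro i _
      rw [← abs_pos, habs]; positivity)
    q hq0.le hq1
    (by
      intro a ha i hi
      rw [hmemF] at ha hi
      rw [habs, habs, ← pow_succ']
      exact pow_le_pow_of_le_one hq0.le hq1.le (by omega))
  obtain ⟨K2, hK2, hXb⟩ := lqX_bound hQ0 hQ1 hs'0 hs'1
  set A := √K2 / q ^ 2 with hA
  have hA0 : 0 ≤ A := by positivity
  refine ⟨2 * (c * A + 2 * c ^ 2 * D * A ^ 2), by positivity, n1 + 1, fun m hm => ?_⟩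
  have hH := lqH_pos hQ0 hQ1 hs'0 hs'1 m
  have key := pert hρ hsum (nz q) hz W c hc hW (2 * m + e) (P (2 * m + e)) (P0 (q ^ 2) s e m)
    (hmonic _) (hdeg _) (P0_monic _ _ _ _) (P0_natDegree _ _ _ _) (γ (2 * m + e))
    (2 * lqH (q ^ 2) (s * (q ^ 2) ^ e) m) (A * (q ^ 2) ^ m) D (by positivity) hD
    (by
      intro g hg
      have := (orth_poly (fun i => (nz q i : ℂ)) (fun i => W i * (nρ s i : ℂ)) P hmonic hdeg γ horth
        (2 * m + e) (2 * m + e) le_rfl g hg).tsum_eq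
      simpa only [mul_assoc] using this)
    (by
      have := (horth (2 * m + e) (2 * m + e)).tsum_eq
      rw [if_pos rfl] at this
      simpa only [mul_assoc] using this)
    (fun g hg => P0_orth hq0 hq1 hs0 hs1 he g hg)
    (P0_sq hq0 hq1 hs0 hs1 e m)
    (P0_N2 hq0 hq1 hs0 hs1 e m)
    (by
      rw [P0_XN2 hq0 hq1 hs0 hs1 e m]
      obtain ⟨m', rfl⟩ : ∃ m', m = m' + 1 := ⟨m - 1, by omega⟩
      have := hXb m'
      have e1 : (A * (q ^ 2) ^ (m' + 1)) ^ 2 = K2 * (q ^ 2) ^ (2 * m') := by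
        rw [hA, pow_succ (q ^ 2) m']
        have : (√K2 / q ^ 2 * ((q ^ 2) ^ m' * q ^ 2)) = √K2 * (q ^ 2) ^ m' := by
          field_simp
        rw [this, mul_pow, Real.sq_sqrt hK2.le, ← pow_mul, mul_comm 2 m']
      rw [e1]
      nlinarith)
    (htest (2 * m + e) (by omega))
  refine key.trans ?_
  have h1 : (q ^ 2) ^ m ≤ 1 := pow_le_one₀ hQ0.le hQ1.le
  have h0 : 0 < (q ^ 2) ^ m := by positivity
  have h2 : (A * (q ^ 2) ^ m) ^ 2 ≤ A ^ 2 * (q ^ 2) ^ m := by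
    rw [mul_pow]
    refine mul_le_mul_of_nonneg_left ?_ (by positivity)
    nlinarith
  have h3 : 2 * c ^ 2 * D * (A * (q ^ 2) ^ m) ^ 2 ≤ 2 * c ^ 2 * D * (A ^ 2 * (q ^ 2) ^ m) :=
    mul_le_mul_of_nonneg_left h2 (by positivity)
  calc (c * (A * (q ^ 2) ^ m) + 2 * c ^ 2 * D * (A * (q ^ 2) ^ m) ^ 2) * (2 * lqH (q ^ 2) (s * (q ^ 2) ^ e) m)
      ≤ (c * (A * (q ^ 2) ^ m) + 2 * c ^ 2 * D * (A ^ 2 * (q ^ 2) ^ m)) * (2 * lqH (q ^ 2) (s * (q ^ 2) ^ e) m) :=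
        mul_le_mul_of_nonneg_right (by linarith) (by linarith)
    _ = _ := by ring

theorem main_eps2 (hq0 : 0 < q) (hq1 : q < 1) (hs0 : 0 < s) (hs1 : s < 1) (W : ℕ ⊕ ℕ → ℂ)
    (c : ℝ) (hc : 0 ≤ c) (hW : ∀ i, ‖W i - 1‖ ≤ c * nz q i ^ 2) (hW0 : ∀ i, W i ≠ 0)
    (P : ℕ → ℂ[X]) (hmonic : ∀ n, (P n).Monic) (hdeg : ∀ n, (P n).natDegree = n) (γ : ℕ → ℂ)
    (horth : ∀ n m : ℕ, HasSum (fun i => (P n).eval (nz q i : ℂ) * (P m).eval (nz q i : ℂ) *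
      (W i * (nρ s i : ℂ))) (if n = m then γ n else 0)) (e : ℕ) (he : e ≤ 1) :
    ∃ C : ℝ, 0 ≤ C ∧ ∃ M : ℕ, ∀ m ≥ M, ∀ R : ℝ,
      R * ((s * (q ^ 2) ^ e) ^ m * (q ^ 2) ^ (m * m) / (q ^ 2) ^ m) = 1 →
      ‖(R : ℂ) * γ (2 * m + e) - 2 * ((lqPinf (q ^ 2) (q ^ 2) : ℝ) : ℂ) ^ 2‖ ≤ C * (q ^ 2) ^ m := by
  have hQ0 : 0 < q ^ 2 := by positivity
  have hQ1 : q ^ 2 < 1 := pow_lt_one₀ hq0.le hq1 (by norm_num)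
  have hs'0 : 0 < s * (q ^ 2) ^ e := by positivity
  have hs'1 := mul_pow_lt_one_aux hQ0 hQ1 hs0 hs1 e
  obtain ⟨C, hC, M, hM⟩ := main_eps hq0 hq1 hs0 hs1 W c hc hW hW0 P hmonic hdeg γ horth e he
  obtain ⟨a, b, C2, ha, hb, hC2, ht⟩ := lqt_bounds hQ0 hQ1 hs'0 hs'1
  refine ⟨C * b + 2 * C2, by positivity, M, fun m hm R hR => ?_⟩
  have hE0 : 0 < (s * (q ^ 2) ^ e) ^ m * (q ^ 2) ^ (m * m) / (q ^ 2) ^ m := by positivity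
  have h := hM m hm
  rw [lqH_eq hQ0 hQ1 hs'0 hs'1 m] at h
  obtain ⟨h1, h2, h3⟩ := ht m
  set E := (s * (q ^ 2) ^ e) ^ m * (q ^ 2) ^ (m * m) / (q ^ 2) ^ m
  set t := lqt (q ^ 2) (s * (q ^ 2) ^ e) m
  set L := lqPinf (q ^ 2) (q ^ 2)
  have hR0 : 0 < R := by
    by_contra hn
    push Not at hn
    nlinarith
  have e1 : (R : ℂ) * γ (2 * m + e) - 2 * (L : ℂ) ^ 2 =
      (R : ℂ) * (γ (2 * m + e) - ((2 * (E * t) : ℝ) : ℂ)) + ((2 * (t - L ^ 2) : ℝ) : ℂ) := by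
    have : (R : ℂ) * (E : ℂ) = 1 := by exact_mod_cast hR
    push_cast
    linear_combination (2 * (t : ℂ)) * this
  rw [e1]
  refine (norm_add_le _ _).trans ?_
  rw [norm_mul, Complex.norm_real, Complex.norm_real, Real.norm_eq_abs, Real.norm_eq_abs, abs_of_pos hR0,
    abs_mul, abs_of_pos (show (0 : ℝ) < 2 by norm_num)]
  have hQm : 0 < (q ^ 2) ^ m := by positivity
  have h4 := mul_le_mul_of_nonneg_left h hR0.le
  have h5 : R * (C * (q ^ 2) ^ m * (E * t)) = C * (q ^ 2) ^ m * t := by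
    linear_combination (C * (q ^ 2) ^ m * t) * hR
  rw [h5] at h4
  have h6 : C * (q ^ 2) ^ m * t ≤ C * (q ^ 2) ^ m * b := mul_le_mul_of_nonneg_left h2 (by positivity)
  nlinarith

end

lemma qpoch_eq (q : ℝ) (hq0 : 0 < q) (hq1 : q < 1) :
    qpochInf ((q : ℂ) ^ 2) (q ^ 2) = ((lqPinf (q ^ 2) (q ^ 2) : ℝ) : ℂ) := by
  have hQ0 : 0 < q ^ 2 := by positivity
  have hQ1 : q ^ 2 < 1 := pow_lt_one₀ hq0.le hq1 (by norm_num)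
  have h := (lqPinf_mult (s := q ^ 2) hQ0 hQ1).hasProd
  have h2 := h.map Complex.ofRealHom Complex.continuous_ofReal
  unfold qpochInf lqPinf
  refine Eq.trans (tprod_congr fun j => ?_) h2.tprod_eq
  simp

lemma exp_id (q α : ℝ) (hq0 : 0 < q) (e m : ℕ) (x : ℝ)
    (hx : x + ((1 + α) + 2 * e) * m + 2 * m * m - 2 * m = 0) :
    q ^ x * ((q ^ (1 + α) * (q ^ 2) ^ e) ^ m * (q ^ 2) ^ (m * m) / (q ^ 2) ^ m) = 1 := by
  have h2 : ∀ k : ℕ, (q ^ 2) ^ k = q ^ (2 * (k : ℝ)) := by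
    intro k
    rw [← pow_mul, ← Real.rpow_natCast]; push_cast; rfl
  rw [h2, h2, h2, ← Real.rpow_add hq0, ← Real.rpow_natCast, ← Real.rpow_mul hq0.le,
    ← Real.rpow_add hq0, ← Real.rpow_sub hq0, ← Real.rpow_add hq0]
  convert Real.rpow_zero q using 2
  push_cast
  linarith

/-- asymptotics of the norms `γ_n` and `γ_{n-1}`. -/
theorem statement2
    (q α : ℝ) (hq0 : 0 < q) (hq1 : q < 1) (hα : -1 < α)
    (r : ℝ) (hr1 : 1 < r) (hr2 : r < q⁻¹)
    (w : ℂ → ℂ) (hw : AnalyticOn ℂ w (Metric.ball (0 : ℂ) r))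
    (hwne : ∀ k : ℕ, w ((q : ℂ) ^ k) ≠ 0 ∧ w (-((q : ℂ) ^ k)) ≠ 0)
    (c : ℝ) (hc : 0 < c) (N₀ : ℕ)
    (hwnear : ∀ n : ℕ, n > N₀ →
      ‖1 - w (((Real.sqrt q ^ n : ℝ) : ℂ))‖ < c * q ^ n ∧
      ‖1 - w (-((Real.sqrt q ^ n : ℝ) : ℂ))‖ < c * q ^ n)
    (P : ℕ → Polynomial ℂ) (hmonic : ∀ n, (P n).Monic) (hdeg : ∀ n, (P n).natDegree = n)
    (γ : ℕ → ℂ) (hγ : ∀ n, γ n ≠ 0)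
    (horth : ∀ n m : ℕ, HasSum
      (fun k : ℕ =>
        ((P n).eval ((q : ℂ) ^ k) * (P m).eval ((q : ℂ) ^ k) * w ((q : ℂ) ^ k) +
          (P n).eval (-((q : ℂ) ^ k)) * (P m).eval (-((q : ℂ) ^ k)) * w (-((q : ℂ) ^ k))) *
        ((q ^ ((k : ℝ) * (1 + α)) : ℝ) : ℂ))
      (if n = m then γ n else 0)) :
    ∃ C : ℝ, 0 < C ∧ ∃ N : ℕ, ∀ n : ℕ, n > N → Even n →
      ‖((q ^ (-((n : ℝ) * ((n : ℝ) - 1 + α)) / 2) : ℝ) : ℂ) * γ n -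
          2 * (qpochInf ((q : ℂ) ^ 2) (q ^ 2)) ^ 2‖ ≤ C * q ^ n ∧
      ‖((q ^ (-(((n : ℝ) - 2) * ((n : ℝ) - 1 + α)) / 2) : ℝ) : ℂ) * γ (n - 1) -
          2 * (qpochInf ((q : ℂ) ^ 2) (q ^ 2)) ^ 2‖ ≤ C * q ^ n := by
  have hQ0 : 0 < q ^ 2 := by positivity
  have hs0 : 0 < q ^ (1 + α) := Real.rpow_pos_of_pos hq0 _
  have hs1 : q ^ (1 + α) < 1 := Real.rpow_lt_one hq0.le hq1 (by linarith)
  have hnl : ∀ k, ((nz q (Sum.inl k) : ℝ) : ℂ) = (q : ℂ) ^ k := fun k => by simp [nz]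
  have hnr : ∀ k, ((nz q (Sum.inr k) : ℝ) : ℂ) = -(q : ℂ) ^ k := fun k => by simp [nz]
  set W : ℕ ⊕ ℕ → ℂ := fun i => w (nz q i : ℂ) with hWdef
  have hW0 : ∀ i, W i ≠ 0 := by
    rintro (k | k)
    · simp only [hWdef, hnl]; exact (hwne k).1
    · simp only [hWdef, hnr]; exact (hwne k).2
  set B : ℕ → ℝ := fun k => (‖W (Sum.inl k) - 1‖ + ‖W (Sum.inr k) - 1‖) / (q ^ k) ^ 2 with hB
  have hB0 : ∀ k, 0 ≤ B k := fun k => by simp only [hB]; positivity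
  set c' := c + ∑ k ∈ Finset.range (N₀ + 1), B k with hc'
  have hS0 : 0 ≤ ∑ k ∈ Finset.range (N₀ + 1), B k := Finset.sum_nonneg fun k _ => hB0 k
  have hc'0 : 0 ≤ c' := by linarith
  have hboth : ∀ k, ‖W (Sum.inl k) - 1‖ ≤ c' * (q ^ k) ^ 2 ∧ ‖W (Sum.inr k) - 1‖ ≤ c' * (q ^ k) ^ 2 := by
    intro k
    have hk0 : 0 < (q ^ k) ^ 2 := by positivity
    by_cases hk : k ≤ N₀
    · have h1 : B k ≤ c' := by
        have := Finset.single_le_sum (f := B) (fun i _ => hB0 i) (Finset.mem_range.2 (Nat.lt_succ_of_le hk))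
        linarith
      simp only [hB] at h1
      rw [div_le_iff₀ hk0] at h1
      constructor <;> linarith [norm_nonneg (W (Sum.inl k) - 1), norm_nonneg (W (Sum.inr k) - 1)]
    · have h1 := hwnear (2 * k) (by omega)
      have h2 : √q ^ (2 * k) = q ^ k := by rw [pow_mul, Real.sq_sqrt hq0.le]
      have h3 : q ^ (2 * k) = (q ^ k) ^ 2 := by rw [← pow_mul, mul_comm]
      rw [h2, h3] at h1
      push_cast at h1
      have h4 : c * (q ^ k) ^ 2 ≤ c' * (q ^ k) ^ 2 := mul_le_mul_of_nonneg_right (by linarith) hk0.le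
      simp only [hWdef, hnl, hnr]
      rw [norm_sub_rev, norm_sub_rev (w (-(q : ℂ) ^ k))]
      exact ⟨h1.1.le.trans h4, h1.2.le.trans h4⟩
  have hW : ∀ i, ‖W i - 1‖ ≤ c' * nz q i ^ 2 := by
    rintro (k | k)
    · exact (hboth k).1
    · simp only [nz, Sum.elim_inr, neg_sq]
      exact (hboth k).2
  have bW : BdF W := by
    refine ⟨c' + 1, fun i => ?_⟩
    have h1 : nz q i ^ 2 ≤ 1 := by
      rw [← sq_abs]; exact pow_le_one₀ (abs_nonneg _) (nz_abs hq0 hq1 i)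
    calc ‖W i‖ = ‖(W i - 1) + 1‖ := by ring_nf
      _ ≤ ‖W i - 1‖ + 1 := by simpa using norm_add_le (W i - 1) 1
      _ ≤ c' + 1 := by nlinarith [hW i]
  have horth' : ∀ n m : ℕ, HasSum (fun i => (P n).eval (nz q i : ℂ) * (P m).eval (nz q i : ℂ) *
      (W i * (nρ (q ^ (1 + α)) i : ℂ))) (if n = m then γ n else 0) := by
    intro n m
    have bp := BdF.poly (nz q) (nz_abs hq0 hq1)
    have hsum := (((bp (P n)).mul (bp (P m))).mul bW).summable (nρ_pos hs0) (nρ_summable hs0 hs1)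
    have hl := (hsum.comp_injective Sum.inl_injective).hasSum
    have hr := (hsum.comp_injective Sum.inr_injective).hasSum
    have h1 := HasSum.sum hl hr
    have h2 := hl.add hr
    have h3 := h2.unique (show HasSum _ (if n = m then γ n else 0) by
      refine (horth n m).congr_fun ?_ |> fun h => h
      intro k
      simp only [Function.comp, hWdef, hnl, hnr, nρ, Sum.elim_inl, Sum.elim_inr]
      have : q ^ ((k : ℝ) * (1 + α)) = (q ^ (1 + α)) ^ k := by
        rw [mul_comm, Real.rpow_mul hq0.le, Real.rpow_natCast]
      rw [this]
      ring)
    rw [h3] at h1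
    simpa only [mul_assoc] using h1
  obtain ⟨C0, hC0, M0, h0⟩ := main_eps2 hq0 hq1 hs0 hs1 W c' hc'0 hW hW0 P hmonic hdeg γ horth' 0 (by norm_num)
  obtain ⟨C1, hC1, M1, h1⟩ := main_eps2 hq0 hq1 hs0 hs1 W c' hc'0 hW hW0 P hmonic hdeg γ horth' 1 (by norm_num)
  refine ⟨C0 + C1 / q ^ 2 + 1, by positivity, 2 * (M0 + M1) + 2, ?_⟩
  intro n hn hev
  obtain ⟨m, rfl⟩ := hev.two_dvd
  rw [qpoch_eq q hq0 hq1]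
  have hqn : q ^ (2 * m) = (q ^ 2) ^ m := by rw [pow_mul]
  have hQm : 0 < (q ^ 2) ^ m := by positivity
  have hC1' : 0 ≤ C1 / q ^ 2 := by positivity
  rw [hqn]
  constructor
  · refine (h0 m (by omega) _ (exp_id q α hq0 0 m _ ?_)).trans ?_
    · push_cast; ring
    · exact mul_le_mul_of_nonneg_right (by linarith) hQm.le
  · obtain ⟨l, rfl⟩ : ∃ l, m = l + 1 := ⟨m - 1, by omega⟩
    have e1 : 2 * (l + 1) - 1 = 2 * l + 1 := by omega
    rw [e1]
    refine (h1 l (by omega) _ (exp_id q α hq0 1 l _ ?_)).trans ?_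
    · push_cast; ring
    · have : C1 * (q ^ 2) ^ l = C1 / q ^ 2 * (q ^ 2) ^ (l + 1) := by
        rw [pow_succ (q ^ 2) l]; field_simp
      rw [this]
      exact mul_le_mul_of_nonneg_right (by linarith) hQm.le
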